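/- arXiv:1811.05174 — 3 statements merged into one kernel-verified Lean document; each statement's English description precedes it below -/
import Mathlib

section
/- For every sequence (ε_n)_{n≥1} of positive numbers tending to 0 there exist a surjective four-valent symbol φ: D → D and a constant C > 0 such that a_n(C_φ) ≤ C e^{−n ε_n} for all n ≥ 1. -/
open Complex MeasureTheory Set Filter
open scoped ENNReal Topology

noncomputable section

/-- The open unit disk in `ℂ`. -/
def unitDisk : Set ℂ := Metric.ball (0 : ℂ) 1

/-- A symbol: a non-constant analytic self-map of the unit disk. -/
structure IsSymbol (φ : ℂ → ℂ) : Prop where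
  mapsTo : Set.MapsTo φ unitDisk unitDisk
  diff : DifferentiableOn ℂ φ unitDisk
  nonconst : ¬ ∃ c : ℂ, Set.EqOn φ (fun _ => c) unitDisk

/-- `φ` is `p`-valent: every `w ∈ 𝔻` has at most `p` preimages in `𝔻`. -/
def Valent (φ : ℂ → ℂ) (p : ℕ) : Prop :=
  ∀ w ∈ unitDisk, (unitDisk ∩ φ ⁻¹' {w}).encard ≤ p

/-- The radial limit of `φ` at the boundary point `toCircle θ` exists and equals `w`.
The circle `𝕋` is parametrized by `AddCircle 1` (so that `volume` is the normalized
Haar measure `m`). -/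
def HasRadialLimit (φ : ℂ → ℂ) (θ : AddCircle (1 : ℝ)) (w : ℂ) : Prop :=
  Filter.Tendsto (fun r : ℝ => φ (r * (AddCircle.toCircle θ : ℂ)))
    (nhdsWithin 1 (Set.Iio 1)) (nhds w)

/-- The pull-back measure `m_φ(S) = m({ξ : φ*(ξ) ∈ S})`. -/
def pullbackMeasure (φ : ℂ → ℂ) (S : Set ℂ) : ℝ≥0∞ :=
  volume {θ : AddCircle (1 : ℝ) | ∃ w ∈ S, HasRadialLimit φ θ w}

/-- `ρ_φ(h) = sup_{ξ ∈ 𝕋} m_φ[S(ξ,h)]`, where `S(ξ,h) = {z : |z - ξ| ≤ h}`. -/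
def rho (φ : ℂ → ℂ) (h : ℝ) : ℝ≥0∞ :=
  ⨆ ξ : Circle, pullbackMeasure φ {z : ℂ | ‖z - (ξ : ℂ)‖ ≤ h}

/-- The `n`-th approximation number of a bounded operator between normed spaces:
the distance of `T` to operators of rank `< n`. -/
def approxNum {E F : Type*} [NormedAddCommGroup E] [NormedAddCommGroup F]
    [NormedSpace ℂ E] [NormedSpace ℂ F] (n : ℕ) (T : E →L[ℂ] F) : ℝ :=
  sInf {c : ℝ | ∃ R : E →L[ℂ] F,
    Module.rank ℂ (LinearMap.range (R : E →ₗ[ℂ] F)) < (n : Cardinal) ∧ c = ‖T - R‖}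

/-- The Hardy space `H²(𝔻)` in its coefficient model `ℓ²(ℕ)`. -/
abbrev H2 := lp (fun _ : ℕ => ℂ) 2

/-- The analytic function on `𝔻` associated with an element of `H²`. -/
def H2.eval (a : H2) (z : ℂ) : ℂ := ∑' n : ℕ, a n * z ^ n

/-- `T` is the composition operator with symbol `φ` on `H²(𝔻)`. -/
def IsCompOp (φ : ℂ → ℂ) (T : H2 →L[ℂ] H2) : Prop :=
  ∀ a : H2, ∀ z ∈ unitDisk, H2.eval (T a) z = H2.eval a (φ z)

/-- The open unit polydisk `𝔻^N`. -/
def polyDisk (N : ℕ) : Set (Fin N → ℂ) := {z | ∀ i, ‖z i‖ < 1}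

/-- The Hardy space `H²(𝔻^N)` in its coefficient model `ℓ²(ℕ^N)`. -/
abbrev H2poly (N : ℕ) := lp (fun _ : Fin N → ℕ => ℂ) 2

/-- The analytic function on `𝔻^N` associated with an element of `H²(𝔻^N)`. -/
def H2poly.eval {N : ℕ} (a : H2poly N) (z : Fin N → ℂ) : ℂ :=
  ∑' α : Fin N → ℕ, a α * ∏ i, z i ^ α i

/-- `T` is the composition operator with symbol `Φ` on `H²(𝔻^N)`. -/
def IsCompOpPoly {N : ℕ} (Φ : (Fin N → ℂ) → (Fin N → ℂ))
    (T : H2poly N →L[ℂ] H2poly N) : Prop :=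
  ∀ a : H2poly N, ∀ z ∈ polyDisk N, H2poly.eval (T a) z = H2poly.eval a (Φ z)

/-- The lens map `λ_θ`. -/
def lens (θ : ℝ) (z : ℂ) : ℂ :=
  ((1 + z) ^ (θ : ℂ) - (1 - z) ^ (θ : ℂ)) / ((1 + z) ^ (θ : ℂ) + (1 - z) ^ (θ : ℂ))

/-- `g` maps `U` into the unit disk, injectively and with non-vanishing derivative. -/
structure IsConformalIntoDisk (U : Set ℂ) (g : ℂ → ℂ) : Prop where
  mapsTo : MapsTo g U (Metric.ball 0 1)
  injOn : InjOn g U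
  deriv_ne_zero : ∀ z ∈ U, deriv g z ≠ 0

/-- The disk automorphism exchanging the origin and `w` up to sign. -/
def diskAut (w ζ : ℂ) : ℂ := (ζ - w) / (1 - (starRingEnd ℂ) w * ζ)

lemma one_sub_conj_mul_ne_zero {w ζ : ℂ} (hw : ‖w‖ < 1) (hζ : ‖ζ‖ < 1) :
    1 - (starRingEnd ℂ) w * ζ ≠ 0 := by
  intro h
  have h1 : ‖(starRingEnd ℂ) w * ζ‖ < 1 := by
    rw [norm_mul, RCLike.norm_conj]
    nlinarith [norm_nonneg w, norm_nonneg ζ]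
  rw [← sub_eq_zero.1 h] at h1
  simp at h1

lemma norm_diskAut_lt_one {w ζ : ℂ} (hw : ‖w‖ < 1) (hζ : ‖ζ‖ < 1) : ‖diskAut w ζ‖ < 1 := by
  have h0 := one_sub_conj_mul_ne_zero hw hζ
  rw [diskAut, norm_div, div_lt_one (norm_pos_iff.2 h0)]
  refine lt_of_pow_lt_pow_left₀ 2 (norm_nonneg _) ?_
  rw [← Complex.normSq_eq_norm_sq, ← Complex.normSq_eq_norm_sq]
  have h1 : Complex.normSq w < 1 := by
    rw [Complex.normSq_eq_norm_sq]; nlinarith [norm_nonneg w]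
  have h2 : Complex.normSq ζ < 1 := by
    rw [Complex.normSq_eq_norm_sq]; nlinarith [norm_nonneg ζ]
  have h3 : Complex.normSq (1 - (starRingEnd ℂ) w * ζ) - Complex.normSq (ζ - w)
      = (1 - Complex.normSq w) * (1 - Complex.normSq ζ) := by
    simp only [Complex.normSq_apply, Complex.sub_re, Complex.sub_im, Complex.mul_re,
      Complex.mul_im, Complex.conj_re, Complex.conj_im, Complex.one_re, Complex.one_im]
    ring
  nlinarith [mul_pos (sub_pos.2 h1) (sub_pos.2 h2)]

lemma hasDerivAt_diskAut {w ζ : ℂ} (hw : ‖w‖ < 1) (hζ : ‖ζ‖ < 1) :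
    HasDerivAt (diskAut w) ((1 - (‖w‖ : ℂ) ^ 2) / (1 - (starRingEnd ℂ) w * ζ) ^ 2) ζ := by
  have h0 := one_sub_conj_mul_ne_zero hw hζ
  have h := ((hasDerivAt_id ζ).sub_const w).div
    (((hasDerivAt_id ζ).const_mul ((starRingEnd ℂ) w)).const_sub 1) h0
  refine h.congr_deriv ?_
  rw [← Complex.mul_conj']
  simp only [id]
  congr 1
  ring

lemma one_sub_norm_sq_ne_zero {w : ℂ} (hw : ‖w‖ < 1) : (1 - (‖w‖ : ℂ) ^ 2) ≠ 0 := by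
  have : (1 - ‖w‖ ^ 2 : ℝ) ≠ 0 := by nlinarith [norm_nonneg w]
  exact_mod_cast this

lemma diskAut_injOn {w : ℂ} (hw : ‖w‖ < 1) : InjOn (diskAut w) (Metric.ball 0 1) := by
  intro x hx y hy h
  rw [mem_ball_zero_iff] at hx hy
  have hx0 := one_sub_conj_mul_ne_zero hw hx
  have hy0 := one_sub_conj_mul_ne_zero hw hy
  rw [diskAut, diskAut, div_eq_div_iff hx0 hy0] at h
  have h1 : (1 - (‖w‖ : ℂ) ^ 2) * (x - y) = 0 := by
    rw [← Complex.mul_conj']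
    linear_combination h
  exact sub_eq_zero.1 ((mul_eq_zero.1 h1).resolve_left (one_sub_norm_sq_ne_zero hw))

namespace IsConformalIntoDisk

variable {U : Set ℂ} {g : ℂ → ℂ}

lemma norm_lt_one (hg : IsConformalIntoDisk U g) {z : ℂ} (hz : z ∈ U) : ‖g z‖ < 1 :=
  mem_ball_zero_iff.1 (hg.mapsTo hz)

lemma differentiableAt (hg : IsConformalIntoDisk U g) {z : ℂ} (hz : z ∈ U) :
    DifferentiableAt ℂ g z :=
  differentiableAt_of_deriv_ne_zero (hg.deriv_ne_zero z hz)

lemma differentiableOn (hg : IsConformalIntoDisk U g) : DifferentiableOn ℂ g U :=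
  fun _ hz => (hg.differentiableAt hz).differentiableWithinAt

lemma deriv_diskAut_comp (hg : IsConformalIntoDisk U g) {w z : ℂ} (hw : ‖w‖ < 1) (hz : z ∈ U) :
    deriv (diskAut w ∘ g) z =
      (1 - (‖w‖ : ℂ) ^ 2) / (1 - (starRingEnd ℂ) w * g z) ^ 2 * deriv g z :=
  ((hasDerivAt_diskAut hw (hg.norm_lt_one hz)).comp z (hg.differentiableAt hz).hasDerivAt).deriv

lemma diskAut_comp (hg : IsConformalIntoDisk U g) {w : ℂ} (hw : ‖w‖ < 1) :
    IsConformalIntoDisk U (diskAut w ∘ g) where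
  mapsTo z hz := mem_ball_zero_iff.2 (norm_diskAut_lt_one hw (hg.norm_lt_one hz))
  injOn := (diskAut_injOn hw).comp hg.injOn hg.mapsTo
  deriv_ne_zero z hz := by
    rw [hg.deriv_diskAut_comp hw hz]
    exact mul_ne_zero (div_ne_zero (one_sub_norm_sq_ne_zero hw)
      (pow_ne_zero _ (one_sub_conj_mul_ne_zero hw (hg.norm_lt_one hz)))) (hg.deriv_ne_zero z hz)

lemma exists_normalized (hg : IsConformalIntoDisk U g) {z : ℂ} (hz : z ∈ U) :
    ∃ k, IsConformalIntoDisk U k ∧ k z = 0 ∧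
      ‖deriv k z‖ * (1 - ‖g z‖ ^ 2) = ‖deriv g z‖ := by
  have hw := hg.norm_lt_one hz
  refine ⟨diskAut (g z) ∘ g, hg.diskAut_comp hw, by simp [diskAut], ?_⟩
  rw [hg.deriv_diskAut_comp hw hz, Complex.conj_mul', norm_mul, norm_div, norm_pow]
  have h2 : ‖(1 - (‖g z‖ : ℂ) ^ 2)‖ = 1 - ‖g z‖ ^ 2 := by
    have : (1 - (‖g z‖ : ℂ) ^ 2) = ((1 - ‖g z‖ ^ 2 : ℝ) : ℂ) := by push_cast; rfl
    rw [this, Complex.norm_real, Real.norm_of_nonneg]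
    nlinarith [norm_nonneg (g z)]
  have h3 : 1 - ‖g z‖ ^ 2 ≠ 0 := by nlinarith [norm_nonneg (g z)]
  rw [h2]
  field_simp

/-- A continuous square root of a conformal map without zeros is conformal. -/
lemma of_sq_eq (hg : IsConformalIntoDisk U g) (hU : IsOpen U) {s : ℂ → ℂ}
    (hs : ContinuousOn s U) (hsq : ∀ z, s z ^ 2 = g z) (h0 : ∀ z ∈ U, g z ≠ 0) :
    IsConformalIntoDisk U s ∧ ∀ z ∈ U, 2 * s z * deriv s z = deriv g z := by
  have hs0 : ∀ z ∈ U, s z ≠ 0 := fun z hz h => h0 z hz (by rw [← hsq z, h]; simp)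
  have hd : ∀ z ∈ U, DifferentiableAt ℂ s z := by
    intro z hz
    have hp : HasStrictDerivAt (fun x : ℂ => x ^ 2) (2 * s z) (s z) := by
      simpa using hasStrictDerivAt_pow 2 (s z)
    have hne : 2 * s z ≠ 0 := mul_ne_zero two_ne_zero (hs0 z hz)
    have hcont : ContinuousAt s z := hs.continuousAt (hU.mem_nhds hz)
    have hl := (hp.hasStrictFDerivAt_equiv hne).eventually_left_inverse
    have hL := hp.to_localInverse hne
    have hev : s =ᶠ[𝓝 z] fun y => hp.localInverse _ _ _ hne (g y) := by
      filter_upwards [hcont.eventually hl] with y hy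
      rw [← hsq y]
      exact hy.symm
    refine DifferentiableAt.congr_of_eventuallyEq ?_ hev
    have h2 := hL.hasDerivAt.differentiableAt
    rw [hsq z] at h2
    exact h2.comp z (hg.differentiableAt hz)
  have hder : ∀ z ∈ U, 2 * s z * deriv s z = deriv g z := by
    intro z hz
    have h1 := (hd z hz).hasDerivAt.pow 2
    have h2 : s ^ 2 = g := funext hsq
    rw [h2] at h1
    rw [h1.deriv]; simp
  refine ⟨⟨fun z hz => ?_, fun x hx y hy h => ?_, fun z hz h => ?_⟩, hder⟩
  · have h1 := hg.norm_lt_one hz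
    rw [← hsq z, norm_pow] at h1
    rw [mem_ball_zero_iff]
    nlinarith [norm_nonneg (s z)]
  · exact hg.injOn hx hy (by rw [← hsq x, ← hsq y, h])
  · exact hg.deriv_ne_zero z hz (by rw [← hder z hz, h, mul_zero])

/-- The Koebe square root trick. -/
lemma exists_norm_deriv_lt (hg : IsConformalIntoDisk U g) (hU : IsOpen U)
    (hUc : IsSimplyConnected U) {z₀ w : ℂ} (hz₀ : z₀ ∈ U) (hg₀ : g z₀ = 0) (hw : ‖w‖ < 1)
    (hwg : w ∉ g '' U) :
    ∃ k, IsConformalIntoDisk U k ∧ k z₀ = 0 ∧ ‖deriv g z₀‖ < ‖deriv k z₀‖ := by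
  have hh := hg.diskAut_comp hw
  have h0 : ∀ z ∈ U, (diskAut w ∘ g) z ≠ 0 := by
    intro z hz h
    have h1 := (div_eq_zero_iff.1 h).resolve_right
      (one_sub_conj_mul_ne_zero hw (hg.norm_lt_one hz))
    exact hwg ⟨z, hz, sub_eq_zero.1 h1⟩
  obtain ⟨s, hsc, hsq⟩ := exists_continuousOn_pow_eq hUc hU hh.differentiableOn.continuousOn
    (by rintro ⟨z, hz, h⟩; exact h0 z hz h) two_ne_zero
  obtain ⟨hs, hder⟩ := hh.of_sq_eq hU hsc hsq h0
  obtain ⟨k, hk, hk0, hkd⟩ := hs.exists_normalized hz₀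
  refine ⟨k, hk, hk0, ?_⟩
  have e1 : ‖s z₀‖ ^ 2 = ‖w‖ := by
    rw [← norm_pow, hsq z₀]
    simp [diskAut, hg₀]
  have e2 : 2 * ‖s z₀‖ * ‖deriv s z₀‖ = (1 - ‖w‖ ^ 2) * ‖deriv g z₀‖ := by
    have h1 := congrArg norm (hder z₀ hz₀)
    rw [hg.deriv_diskAut_comp hw hz₀, hg₀] at h1
    have h2 : ‖(1 - (‖w‖ : ℂ) ^ 2)‖ = 1 - ‖w‖ ^ 2 := by
      have : (1 - (‖w‖ : ℂ) ^ 2) = ((1 - ‖w‖ ^ 2 : ℝ) : ℂ) := by push_cast; rfl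
      rw [this, Complex.norm_real, Real.norm_of_nonneg]
      nlinarith [norm_nonneg w]
    simpa [h2] using h1
  have hg' : 0 < ‖deriv g z₀‖ := norm_pos_iff.2 (hg.deriv_ne_zero z₀ hz₀)
  have ha : ‖s z₀‖ < 1 := hs.norm_lt_one hz₀
  have ha0 : 0 < ‖s z₀‖ := by
    refine norm_pos_iff.2 fun h => h0 z₀ hz₀ ?_
    rw [← hsq z₀, h]; simp
  set a := ‖s z₀‖
  rw [← e1] at e2
  rw [← hkd] at e2
  have e3 : (2 * a * ‖deriv k z₀‖ - (1 + a ^ 2) * ‖deriv g z₀‖) * (1 - a ^ 2) = 0 := by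
    linear_combination e2
  have e4 := (mul_eq_zero.1 e3).resolve_right (by nlinarith)
  nlinarith [mul_pos hg' (pow_pos (sub_pos.2 ha) 2)]

end IsConformalIntoDisk

/-- A form of Hurwitz's theorem. -/
lemma TendstoLocallyUniformlyOn.eventually_mem_image {ι : Type*} {p : Filter ι}
    {U V : Set ℂ} {F : ι → ℂ → ℂ} {f : ℂ → ℂ} {c : ι → ℂ} {b : ℂ} (hU : IsOpen U)
    (hF : TendstoLocallyUniformlyOn F f p U) (hd : ∀ i, DifferentiableOn ℂ (F i) U)
    (hf : DifferentiableOn ℂ f U) (hb : b ∈ U) (hc : Tendsto c p (𝓝 (f b)))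
    (hne : ¬ ∀ᶠ z in 𝓝 b, f z = f b) (hV : V ∈ 𝓝 b) :
    ∀ᶠ i in p, c i ∈ F i '' V := by
  have hfa : AnalyticAt ℂ f b := hf.analyticAt (hU.mem_nhds hb)
  have h1 := (hfa.eventually_eq_or_eventually_ne analyticAt_const).resolve_left hne
  obtain ⟨ρ, hρ, h2⟩ := Metric.nhds_basis_closedBall.mem_iff.1
    (inter_mem (inter_mem (hU.mem_nhds hb) hV) (eventually_nhdsWithin_iff.1 h1))
  have hsub : Metric.closedBall b ρ ⊆ U := fun z hz => (h2 hz).1.1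
  have h3 : ∀ z ∈ Metric.sphere b ρ, f z ≠ f b := fun z hz =>
    (h2 (Metric.sphere_subset_closedBall hz)).2 (Metric.ne_of_mem_sphere hz hρ.ne')
  have h4 : (Metric.sphere b ρ).Nonempty := NormedSpace.sphere_nonempty.2 hρ.le
  obtain ⟨x, hx, hmin⟩ := (isCompact_sphere b ρ).exists_isMinOn h4
    (((hf.continuousOn.mono hsub).sub continuousOn_const).norm.mono
      Metric.sphere_subset_closedBall : ContinuousOn (fun z => ‖f z - f b‖) _)
  set m := ‖f x - f b‖
  have hm : 0 < m := norm_sub_pos_iff.2 (h3 x hx)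
  have hunif := (tendstoLocallyUniformlyOn_iff_forall_isCompact hU).1 hF _ hsub
    (isCompact_closedBall b ρ)
  filter_upwards [Metric.tendstoUniformlyOn_iff.1 hunif (m / 8) (by positivity),
    Metric.tendsto_nhds.1 hc (m / 8) (by positivity)] with i hi hci
  have hbb : b ∈ Metric.closedBall b ρ := Metric.mem_closedBall_self hρ.le
  have hib := hi b hbb
  have hlow : ∀ z ∈ Metric.sphere b ρ, m / 2 ≤ ‖F i z - F i b‖ := by
    intro z hz
    have e1 := hi z (Metric.sphere_subset_closedBall hz)
    have e2 : m ≤ ‖f z - f b‖ := hmin hz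
    rw [dist_eq_norm] at e1 hib
    have e3 : f z - f b = (f z - F i z) + (F i z - F i b) - (f b - F i b) := by ring
    have e4 := norm_sub_le ((f z - F i z) + (F i z - F i b)) (f b - F i b)
    have e5 := norm_add_le (f z - F i z) (F i z - F i b)
    rw [← e3] at e4
    linarith
  have hfreq : ∃ᶠ z in 𝓝 b, F i z ≠ F i b := by
    intro hcon
    have h5 : ∀ᶠ z in 𝓝 b, F i z = F i b := by simpa using hcon
    have hA : AnalyticOnNhd ℂ (F i) (Metric.closedBall b ρ) :=
      ((hd i).analyticOnNhd hU).mono hsub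
    have h6 := hA.eqOn_of_preconnected_of_eventuallyEq analyticOnNhd_const
      (convex_closedBall b ρ).isPreconnected hbb h5
    have h7 := hlow x hx
    rw [h6 (Metric.sphere_subset_closedBall hx)] at h7
    simp at h7
    linarith
  have hdc : DiffContOnCl ℂ (F i) (Metric.ball b ρ) :=
    ((hd i).mono hsub).diffContOnCl_ball (Subset.refl _)
  obtain ⟨z, hz, hzc⟩ := hdc.ball_subset_image_closedBall hρ hlow hfreq
    (show c i ∈ Metric.ball (F i b) (m / 2 / 2) by
      have := dist_triangle (c i) (f b) (F i b)
      rw [Metric.mem_ball]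
      linarith)
  exact ⟨z, (h2 hz).1.2, hzc⟩

/-- Pointwise convergence of maps into the unit disk is locally uniform. -/
lemma tendstoLocallyUniformlyOn_of_mapsTo_ball {ι : Type*} {p : Filter ι} [p.NeBot] {U : Set ℂ}
    {F : ι → ℂ → ℂ} {f : ℂ → ℂ} (hU : IsOpen U) (hd : ∀ i, DifferentiableOn ℂ (F i) U)
    (hF : ∀ i, MapsTo (F i) U (Metric.ball 0 1))
    (hf : ∀ z ∈ U, Tendsto (fun i => F i z) p (𝓝 (f z))) :
    TendstoLocallyUniformlyOn F f p U := by
  rw [Metric.tendstoLocallyUniformlyOn_iff]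
  intro ε hε x hx
  obtain ⟨R, hR, hRU⟩ := Metric.isOpen_iff.1 hU x hx
  have hlip : ∀ i, ∀ z ∈ Metric.ball x R, dist (F i z) (F i x) ≤ 2 / R * dist z x := by
    intro i z hz
    refine Complex.dist_le_div_mul_dist_of_mapsTo_ball ((hd i).mono hRU) ?_ hz
    intro y hy
    have h1 := mem_ball_zero_iff.1 (hF i (hRU hy))
    have h2 := mem_ball_zero_iff.1 (hF i hx)
    rw [Metric.mem_closedBall, dist_eq_norm]
    linarith [norm_sub_le (F i y) (F i x)]
  have hlipf : ∀ z ∈ Metric.ball x R, dist (f z) (f x) ≤ 2 / R * dist z x := fun z hz =>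
    le_of_tendsto ((hf z (hRU hz)).dist (hf x hx)) (Eventually.of_forall fun i => hlip i z hz)
  set δ := min R (ε * R / 8)
  have hδ : 0 < δ := by positivity
  refine ⟨Metric.ball x δ, mem_nhdsWithin_of_mem_nhds (Metric.ball_mem_nhds x hδ), ?_⟩
  filter_upwards [Metric.tendsto_nhds.1 (hf x hx) (ε / 4) (by positivity)] with i hi y hy
  have hy1 : dist y x < R := lt_of_lt_of_le hy (min_le_left _ _)
  have hy2 : dist y x < ε * R / 8 := lt_of_lt_of_le hy (min_le_right _ _)
  have hy3 : 2 / R * dist y x < ε / 4 := by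
    rw [div_mul_eq_mul_div, div_lt_iff₀ hR]
    linarith
  have e1 := hlip i y hy1
  have e2 := hlipf y hy1
  have e3 := dist_triangle4 (f y) (f x) (F i x) (F i y)
  rw [dist_comm (f x), dist_comm (F i x) (F i y)] at e3
  linarith

namespace IsConformalIntoDisk

variable {U : Set ℂ}

/-- A locally uniform limit of normalized conformal maps into the disk is conformal, unless its
derivative vanishes at the base point. -/
lemma of_tendsto {ι : Type*} {p : Filter ι} [p.NeBot] {F : ι → ℂ → ℂ} {g : ℂ → ℂ} {z₀ : ℂ}
    (hU : IsOpen U) (hUc : IsPreconnected U) (hF : ∀ i, IsConformalIntoDisk U (F i))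
    (hz₀ : z₀ ∈ U) (hg : TendstoLocallyUniformlyOn F g p U) (hg' : deriv g z₀ ≠ 0) :
    IsConformalIntoDisk U g := by
  have hd : ∀ i, DifferentiableOn ℂ (F i) U := fun i => (hF i).differentiableOn
  have hgd : DifferentiableOn ℂ g U :=
    hg.differentiableOn (Eventually.of_forall hd) hU
  have hga : AnalyticOnNhd ℂ g U := hgd.analyticOnNhd hU
  have hnc : ∀ b ∈ U, ¬ ∀ᶠ z in 𝓝 b, g z = g b := by
    intro b hb hcon
    have h1 := hga.eqOn_of_preconnected_of_eventuallyEq analyticOnNhd_const hUc hb hcon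
    have h2 : g =ᶠ[𝓝 z₀] fun _ => g b := h1.eventuallyEq_of_mem (hU.mem_nhds hz₀)
    exact hg' (by rw [h2.deriv_eq]; simp)
  have hle : ∀ z ∈ U, g z ∈ Metric.closedBall (0 : ℂ) 1 := fun z hz =>
    Metric.isClosed_closedBall.mem_of_tendsto (hg.tendsto_at hz)
      (Eventually.of_forall fun i => Metric.ball_subset_closedBall ((hF i).mapsTo hz))
  refine ⟨fun z hz => ?_, fun a ha b hb hab => ?_, fun z hz hz0 => ?_⟩
  · rcases hga.is_constant_or_isOpen hUc with ⟨w, hw⟩ | h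
    · exact absurd (eventually_of_mem (hU.mem_nhds hz)
        fun y hy => (hw y hy).trans (hw z hz).symm) (hnc z hz)
    · have h1 := interior_maximal (mapsTo_iff_image_subset.1 hle) (h U Subset.rfl hU)
      rw [interior_closedBall _ one_ne_zero] at h1
      exact h1 (mem_image_of_mem g hz)
  · by_contra hne
    have h1 := hg.eventually_mem_image (V := U \ {a}) hU hd hgd hb
      (c := fun i => F i a) (hab ▸ hg.tendsto_at ha) (hnc b hb)
      (inter_mem (hU.mem_nhds hb) (isOpen_compl_singleton.mem_nhds (Ne.symm hne)))
    obtain ⟨i, y, hy, hyi⟩ := h1.exists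
    exact hy.2 ((hF i).injOn hy.1 ha hyi)
  · have hder := hg.deriv (Eventually.of_forall hd) hU
    have h1 : ¬ ∀ᶠ y in 𝓝 z, deriv g y = deriv g z := by
      intro hcon
      have h2 := (hga.deriv).eqOn_of_preconnected_of_eventuallyEq analyticOnNhd_const hUc hz hcon
      exact hg' ((h2 hz₀).trans hz0)
    have h2 := hder.eventually_mem_image (V := U) hU
      (fun i => ((hd i).analyticOnNhd hU).deriv.differentiableOn) hga.deriv.differentiableOn hz
      (c := fun _ => 0) (by rw [hz0]; exact tendsto_const_nhds) h1 (hU.mem_nhds hz)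
    obtain ⟨i, y, hy, hyi⟩ := h2.exists
    exact (hF i).deriv_ne_zero y hy hyi

lemma exists_maximal {f : ℂ → ℂ} (hf : IsConformalIntoDisk U f) (hU : IsOpen U)
    (hUc : IsPreconnected U) {z₀ : ℂ} (hz₀ : z₀ ∈ U) :
    ∃ g, IsConformalIntoDisk U g ∧ g z₀ = 0 ∧
      ∀ k, IsConformalIntoDisk U k → k z₀ = 0 → ‖deriv k z₀‖ ≤ ‖deriv g z₀‖ := by
  set S : Set ℝ := {x | ∃ k, IsConformalIntoDisk U k ∧ k z₀ = 0 ∧ ‖deriv k z₀‖ = x}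
  obtain ⟨k₀, hk₀, hk₀0, -⟩ := hf.exists_normalized hz₀
  have hne : S.Nonempty := ⟨_, k₀, hk₀, hk₀0, rfl⟩
  obtain ⟨R, hR, hRU⟩ := Metric.isOpen_iff.1 hU z₀ hz₀
  have hbdd : BddAbove S := by
    refine ⟨1 / R, ?_⟩
    rintro _ ⟨k, hk, hk0, rfl⟩
    refine Complex.norm_deriv_le_div_of_mapsTo_ball (hk.differentiableOn.mono hRU) ?_ hR
    rw [hk0]
    exact fun z hz => Metric.ball_subset_closedBall (hk.mapsTo (hRU hz))
  obtain ⟨u, -, hu, huS⟩ := exists_seq_tendsto_sSup hne hbdd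
  choose F hF hF0 hFu using huS
  set p : Ultrafilter ℕ := Ultrafilter.of atTop
  have hp : (p : Filter ℕ) ≤ atTop := Ultrafilter.of_le _
  have hlim : ∀ z, ∃ y, z ∈ U → Tendsto (fun i => F i z) p (𝓝 y) := by
    intro z
    by_cases hz : z ∈ U
    · obtain ⟨y, -, hy⟩ := (isCompact_closedBall (0 : ℂ) 1).ultrafilter_le_nhds
        (p.map fun i => F i z) (by
          rw [le_principal_iff, Ultrafilter.coe_map, Filter.mem_map]
          exact univ_mem' fun i => Metric.ball_subset_closedBall ((hF i).mapsTo hz))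
      exact ⟨y, fun _ => hy⟩
    · exact ⟨0, fun h => absurd h hz⟩
  choose g hg using hlim
  have hloc : TendstoLocallyUniformlyOn F g p U :=
    tendstoLocallyUniformlyOn_of_mapsTo_ball hU (fun i => (hF i).differentiableOn)
      (fun i => (hF i).mapsTo) hg
  have hder :=
    (hloc.deriv (Eventually.of_forall fun i => (hF i).differentiableOn) hU).tendsto_at hz₀
  have hsup : ‖deriv g z₀‖ = sSup S := by
    refine tendsto_nhds_unique hder.norm ((hu.mono_left hp).congr fun n => (hFu n).symm)
  have hmax : ∀ k, IsConformalIntoDisk U k → k z₀ = 0 → ‖deriv k z₀‖ ≤ ‖deriv g z₀‖ := by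
    intro k hk hk0
    rw [hsup]
    exact le_csSup hbdd ⟨k, hk, hk0, rfl⟩
  have hg' : deriv g z₀ ≠ 0 := norm_pos_iff.1
    ((norm_pos_iff.2 (hk₀.deriv_ne_zero z₀ hz₀)).trans_le (hmax k₀ hk₀ hk₀0))
  refine ⟨g, of_tendsto hU hUc hF hz₀ hloc hg', ?_, hmax⟩
  exact tendsto_nhds_unique (hg z₀ hz₀) (by simp [hF0])

end IsConformalIntoDisk

/-- The Riemann mapping theorem, for domains that can be mapped conformally into the disk. -/
theorem exists_differentiableOn_bijOn_ball {U : Set ℂ} {f₀ : ℂ → ℂ} (hU : IsOpen U)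
    (hUc : IsSimplyConnected U) (hf₀ : IsConformalIntoDisk U f₀) :
    ∃ f : ℂ → ℂ, DifferentiableOn ℂ f (Metric.ball 0 1) ∧ BijOn f (Metric.ball 0 1) U := by
  obtain ⟨z₀, hz₀⟩ := hUc.nonempty
  have hpre : IsPreconnected U := hUc.isPathConnected.isConnected.isPreconnected
  obtain ⟨g, hg, hg0, hmax⟩ := hf₀.exists_maximal hU hpre hz₀
  have hsurj : SurjOn g U (Metric.ball 0 1) := by
    intro w hw
    by_contra hwg
    obtain ⟨k, hk, hk0, hlt⟩ :=
      hg.exists_norm_deriv_lt hU hUc hz₀ hg0 (mem_ball_zero_iff.1 hw) hwg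
    exact absurd (hmax k hk hk0) (not_le.2 hlt)
  have hbij : BijOn g U (Metric.ball 0 1) := ⟨hg.mapsTo, hg.injOn, hsurj⟩
  have hinv := hbij.invOn_invFunOn
  refine ⟨Function.invFunOn g U, fun w hw => ?_, hinv.symm.bijOn
    hsurj.mapsTo_invFunOn hg.mapsTo⟩
  have hwU : Function.invFunOn g U w ∈ U := hsurj.mapsTo_invFunOn hw
  refine DifferentiableAt.differentiableWithinAt ?_
  have hopen : ∀ V ⊆ U, IsOpen V → IsOpen (g '' V) := by
    rcases (hg.differentiableOn.analyticOnNhd hU).is_constant_or_isOpen hpre with ⟨c, hc⟩ | h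
    · exfalso
      have h4 : g =ᶠ[𝓝 z₀] fun _ => c := eventually_of_mem (hU.mem_nhds hz₀) hc
      exact hg.deriv_ne_zero z₀ hz₀ (by rw [h4.deriv_eq]; simp)
    · exact h
  have hcont : ContinuousAt (Function.invFunOn g U) w := by
    rw [ContinuousAt, _root_.tendsto_nhds]
    intro s hs hws
    have h5 : g '' (s ∩ U) ∈ 𝓝 w := (hopen _ inter_subset_right (hs.inter hU)).mem_nhds
      ⟨_, ⟨hws, hwU⟩, hinv.2 hw⟩
    filter_upwards [h5]
    rintro _ ⟨y, hy, rfl⟩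
    rw [mem_preimage, hinv.1 hy.2]
    exact hy.1
  exact ((hg.differentiableAt hwU).hasDerivAt.of_local_left_inverse hcont
    (hg.deriv_ne_zero _ hwU) (eventually_of_mem (Metric.isOpen_ball.mem_nhds hw)
      fun y hy => hinv.2 hy)).differentiableAt

/-- The domain swept out by the vertical segments of length `4π` standing on the graph of `ψ`. -/
def verticalStrip (ψ : ℝ → ℝ) : Set ℂ :=
  {z | 0 < z.re ∧ ψ z.re < z.im ∧ z.im < ψ z.re + 4 * Real.pi}

lemma isOpen_verticalStrip {ψ : ℝ → ℝ} (hψ : ContinuousOn ψ (Ioi 0)) :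
    IsOpen (verticalStrip ψ) := by
  have hU : IsOpen {z : ℂ | 0 < z.re} := isOpen_lt continuous_const Complex.continuous_re
  have hc : ContinuousOn (fun z : ℂ => ψ z.re) {z : ℂ | 0 < z.re} :=
    hψ.comp Complex.continuous_re.continuousOn fun z hz => hz
  have h1 := ((Complex.continuous_im.continuousOn).sub hc).isOpen_inter_preimage hU
    (isOpen_Ioo (a := (0 : ℝ)) (b := 4 * Real.pi))
  convert h1 using 1
  ext z
  simp only [verticalStrip, mem_ofPred_eq, mem_inter_iff, mem_preimage, mem_Ioo, Pi.sub_apply]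
  constructor
  · rintro ⟨h1, h2, h3⟩
    exact ⟨h1, by linarith, by linarith⟩
  · rintro ⟨h1, h2, h3⟩
    exact ⟨h1, by linarith, by linarith⟩

/-- Vertical shearing straightens `verticalStrip ψ`. -/
def verticalStripHomeomorph {ψ : ℝ → ℝ} (hψ : ContinuousOn ψ (Ioi 0)) :
    verticalStrip 0 ≃ₜ verticalStrip ψ where
  toFun z := ⟨(z : ℂ) + ψ (z : ℂ).re * I, by
    obtain ⟨z, h1, h2, h3⟩ := z
    simp only [Pi.zero_apply] at h2 h3
    refine ⟨?_, ?_, ?_⟩ <;> simp <;> linarith⟩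
  invFun z := ⟨(z : ℂ) - ψ (z : ℂ).re * I, by
    obtain ⟨z, h1, h2, h3⟩ := z
    refine ⟨?_, ?_, ?_⟩ <;> simp <;> linarith⟩
  left_inv z := by ext; simp
  right_inv z := by ext; simp
  continuous_toFun := by
    have : Continuous fun z : verticalStrip 0 => ψ (z : ℂ).re :=
      hψ.comp_continuous (by fun_prop) fun z => z.2.1
    exact (continuous_subtype_val.add
      ((Complex.continuous_ofReal.comp this).mul continuous_const)).subtype_mk _
  continuous_invFun := by
    have : Continuous fun z : verticalStrip ψ => ψ (z : ℂ).re :=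
      hψ.comp_continuous (by fun_prop) fun z => z.2.1
    exact (continuous_subtype_val.sub
      ((Complex.continuous_ofReal.comp this).mul continuous_const)).subtype_mk _

lemma convex_verticalStrip_zero : Convex ℝ (verticalStrip 0) := by
  have h : verticalStrip 0 = {z : ℂ | 0 < z.re} ∩ ({z : ℂ | 0 < z.im} ∩
      {z : ℂ | z.im < 4 * Real.pi}) := by
    ext z; simp [verticalStrip]
  rw [h]
  exact (convex_halfSpace_re_gt 0).inter ((convex_halfSpace_im_gt 0).inter
    (convex_halfSpace_im_lt _))

lemma isSimplyConnected_verticalStrip {ψ : ℝ → ℝ} (hψ : ContinuousOn ψ (Ioi 0)) :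
    IsSimplyConnected (verticalStrip ψ) := by
  have hne : (verticalStrip 0).Nonempty := ⟨1 + I, by
    refine ⟨?_, ?_, ?_⟩ <;> simp
    linarith [Real.pi_gt_three]⟩
  have := convex_verticalStrip_zero.contractibleSpace hne
  have h : SimplyConnectedSpace (verticalStrip 0) := inferInstance
  exact (verticalStripHomeomorph hψ).toHomotopyEquiv.simplyConnectedSpace_iff.1 h

lemma isConformalIntoDisk_cayley {U : Set ℂ} (hU : ∀ z ∈ U, 0 < z.re) :
    IsConformalIntoDisk U fun z => (z - 1) / (z + 1) := by
  have h0 : ∀ z ∈ U, z + 1 ≠ 0 := by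
    intro z hz h
    have h1 := congrArg Complex.re h
    have h2 := hU z hz
    simp at h1
    linarith
  refine ⟨fun z hz => ?_, fun x hx y hy h => ?_, fun z hz => ?_⟩
  · rw [mem_ball_zero_iff, norm_div, div_lt_one (norm_pos_iff.2 (h0 z hz))]
    refine lt_of_pow_lt_pow_left₀ 2 (norm_nonneg _) ?_
    rw [← Complex.normSq_eq_norm_sq, ← Complex.normSq_eq_norm_sq]
    have h2 := hU z hz
    simp only [Complex.normSq_apply, Complex.sub_re, Complex.sub_im, Complex.add_re,
      Complex.add_im, Complex.one_re, Complex.one_im]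
    nlinarith
  · replace h : (x - 1) / (x + 1) = (y - 1) / (y + 1) := h
    rw [div_eq_div_iff (h0 x hx) (h0 y hy)] at h
    linear_combination h / 2
  · have h1 := ((hasDerivAt_id z).sub_const 1).div ((hasDerivAt_id z).add_const 1) (h0 z hz)
    have h2 : deriv (fun z : ℂ => (z - 1) / (z + 1)) z = 2 / (z + 1) ^ 2 := by
      refine (h1.congr_deriv ?_).deriv
      simp only [id]
      congr 1
      ring
    rw [h2]
    exact div_ne_zero two_ne_zero (pow_ne_zero _ (h0 z hz))

/-- Below each point of the punctured disk, the exponential map on `verticalStrip ψ` has at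
least one and at most two points, at distance `2π`. -/
lemma exists_exp_neg_eq_iff {ψ : ℝ → ℝ} {w : ℂ} (hw0 : w ≠ 0) (hw1 : ‖w‖ < 1) :
    ∃ c ∈ verticalStrip ψ, exp (-c) = w ∧
      ∀ z ∈ verticalStrip ψ, exp (-z) = w → z = c ∨ z = c + 2 * Real.pi * I := by
  set m := toIocDiv Real.two_pi_pos (ψ (-Real.log ‖w‖)) (-arg w)
  have hm := sub_toIocDiv_zsmul_mem_Ioc Real.two_pi_pos (ψ (-Real.log ‖w‖)) (-arg w)
  set c : ℂ := -log w - m * (2 * Real.pi * I) with hc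
  have hcre : c.re = -Real.log ‖w‖ := by simp [hc, Complex.log_re]
  have hcim : c.im = -arg w - m * (2 * Real.pi) := by simp [hc, Complex.log_im]
  have hx : 0 < -Real.log ‖w‖ := neg_pos.2 (Real.log_neg (norm_pos_iff.2 hw0) hw1)
  rw [zsmul_eq_mul, ← hcim] at hm
  obtain ⟨hm1, hm2⟩ := hm
  have hpi := Real.pi_pos
  have hexp : exp (-c) = w := by
    rw [hc, neg_sub, sub_neg_eq_add, exp_add, exp_int_mul_two_pi_mul_I, one_mul, exp_log hw0]
  refine ⟨c, ⟨by rw [hcre]; exact hx, by rw [hcre]; exact hm1, by rw [hcre]; linarith⟩, hexp, ?_⟩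
  rintro z ⟨-, hz2, hz3⟩ hz
  obtain ⟨n, hn⟩ := exp_eq_exp_iff_exists_int.1 (hexp.trans hz.symm)
  have hn' : z = c + n * (2 * Real.pi * I) := by linear_combination hn
  have hre : z.re = -Real.log ‖w‖ := by rw [hn', ← hcre]; simp
  have him : z.im = c.im + n * (2 * Real.pi) := by rw [hn']; simp
  rw [hre] at hz2 hz3
  have h1 : (-1 : ℝ) < n := by
    by_contra! h
    nlinarith
  have h2 : (n : ℝ) < 2 := by
    by_contra! h
    nlinarith
  have h3 : (-1 : ℤ) < n := by exact_mod_cast h1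
  have h4 : n < 2 := by exact_mod_cast h2
  obtain rfl | rfl : n = 0 ∨ n = 1 := by omega
  · left; simpa using hn'
  · right; simpa using hn'

/-- The factorization of the equation `w * diskAut (1 / 2) w = v`. -/
lemma exists_factor_blaschke (v : ℂ) : ∃ w₁ w₂ : ℂ, w₁ * w₂ = -v ∧
    ∀ w : ℂ, ‖w‖ < 1 → (w * diskAut (1 / 2) w = v ↔ w = w₁ ∨ w = w₂) := by
  obtain ⟨d, hd⟩ := IsAlgClosed.exists_pow_nat_eq (((1 - v) / 2) ^ 2 + 4 * v) two_pos
  refine ⟨((1 - v) / 2 + d) / 2, ((1 - v) / 2 - d) / 2, by linear_combination -hd / 4, ?_⟩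
  intro w hw
  have h0 := one_sub_conj_mul_ne_zero (w := 1 / 2) (by norm_num) hw
  rw [diskAut, mul_div_assoc', div_eq_iff h0, ← sub_eq_zero, ← sub_eq_zero (b := _ / 2),
    ← sub_eq_zero (a := w) (b := ((1 - v) / 2 - d) / 2), ← mul_eq_zero]
  have h2 : (starRingEnd ℂ) (1 / 2) = 1 / 2 := by
    rw [map_div₀, map_one, map_ofNat]
  rw [h2]
  constructor <;> intro h
  · linear_combination h - hd / 4
  · linear_combination h + hd / 4

/-- A four-valent surjective symbol controlled by a map into a prescribed thin spiral. -/
lemma exists_fourValent_symbol {ψ : ℝ → ℝ} (hψ : ContinuousOn ψ (Ioi 0)) :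
    ∃ φ f : ℂ → ℂ, IsSymbol φ ∧ φ '' unitDisk = unitDisk ∧ Valent φ 4 ∧
      DifferentiableOn ℂ f unitDisk ∧ ∀ z ∈ unitDisk,
        0 < (f z).re ∧ ψ (f z).re < (f z).im ∧ ‖φ z‖ ≤ Real.exp (-(f z).re) := by
  obtain ⟨f, hfd, hf⟩ := exists_differentiableOn_bijOn_ball (isOpen_verticalStrip hψ)
    (isSimplyConnected_verticalStrip hψ) (isConformalIntoDisk_cayley fun z hz => hz.1)
  set e : ℂ → ℂ := fun z => exp (-f z)
  have hnorm : ∀ z, ‖e z‖ = Real.exp (-(f z).re) := fun z => by simp [e, Complex.norm_exp]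
  have he : ∀ z ∈ unitDisk, ‖e z‖ < 1 := by
    intro z hz
    rw [hnorm, Real.exp_lt_one_iff, neg_lt_zero]
    exact (hf.mapsTo hz).1
  have hhalf : ‖(1 / 2 : ℂ)‖ < 1 := by norm_num
  set φ : ℂ → ℂ := fun z => e z * diskAut (1 / 2) (e z)
  have hφ : ∀ z ∈ unitDisk, ‖φ z‖ ≤ ‖e z‖ := by
    intro z hz
    rw [norm_mul]
    exact mul_le_of_le_one_right (norm_nonneg _) (norm_diskAut_lt_one hhalf (he z hz)).le
  have hmaps : MapsTo φ unitDisk unitDisk := fun z hz =>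
    mem_ball_zero_iff.2 ((hφ z hz).trans_lt (he z hz))
  have hsurj_e : ∀ w : ℂ, w ≠ 0 → ‖w‖ < 1 → ∃ z ∈ unitDisk, e z = w := by
    intro w hw0 hw1
    obtain ⟨c, hc, hcw, -⟩ := exists_exp_neg_eq_iff (ψ := ψ) hw0 hw1
    obtain ⟨z, hz, rfl⟩ := hf.surjOn hc
    exact ⟨z, hz, hcw⟩
  have hval_e : ∀ w : ℂ, (unitDisk ∩ e ⁻¹' {w}).encard ≤ 2 := by
    intro w
    rcases (unitDisk ∩ e ⁻¹' {w}).eq_empty_or_nonempty with h | ⟨z₀, hz₀, rfl⟩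
    · simp [h]
    obtain ⟨c, -, -, hc⟩ := exists_exp_neg_eq_iff (ψ := ψ) (w := e z₀) (exp_ne_zero _) (he z₀ hz₀)
    have hinj : InjOn f (unitDisk ∩ e ⁻¹' {e z₀}) := hf.injOn.mono inter_subset_left
    rw [← hinj.encard_image]
    refine (encard_le_encard (t := {c, c + 2 * Real.pi * I}) ?_).trans ?_
    swap
    · exact (encard_insert_le _ _).trans_eq (by rw [encard_singleton]; norm_num)
    rintro _ ⟨z, ⟨hz, hze⟩, rfl⟩
    exact hc _ (hf.mapsTo hz) hze
  have himage : φ '' unitDisk = unitDisk := by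
    refine Subset.antisymm (image_subset_iff.2 hmaps) fun v hv => ?_
    have hv1 : ‖v‖ < 1 := mem_ball_zero_iff.1 hv
    suffices h : ∃ w : ℂ, w ≠ 0 ∧ ‖w‖ < 1 ∧ w * diskAut (1 / 2) w = v by
      obtain ⟨w, hw0, hw1, hwv⟩ := h
      obtain ⟨z, hz, rfl⟩ := hsurj_e w hw0 hw1
      exact ⟨z, hz, hwv⟩
    by_cases hv0 : v = 0
    · exact ⟨1 / 2, by norm_num, hhalf, by simp [hv0, diskAut]⟩
    obtain ⟨w₁, w₂, hprod, hw⟩ := exists_factor_blaschke v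
    have hne : w₁ * w₂ ≠ 0 := by rw [hprod]; exact neg_ne_zero.2 hv0
    by_cases h1 : ‖w₁‖ < 1
    · exact ⟨w₁, left_ne_zero_of_mul hne, h1, (hw w₁ h1).2 (Or.inl rfl)⟩
    by_cases h2 : ‖w₂‖ < 1
    · exact ⟨w₂, right_ne_zero_of_mul hne, h2, (hw w₂ h2).2 (Or.inr rfl)⟩
    have h3 : ‖w₁‖ * ‖w₂‖ = ‖v‖ := by rw [← norm_mul, hprod, norm_neg]
    nlinarith
  refine ⟨φ, f, ⟨hmaps, ?_, ?_⟩, himage, ?_, hfd, fun z hz =>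
    ⟨(hf.mapsTo hz).1, (hf.mapsTo hz).2.1, (hφ z hz).trans_eq (hnorm z)⟩⟩
  · have hed : DifferentiableOn ℂ e unitDisk := hfd.neg.cexp
    refine hed.mul fun z hz => ?_
    exact (hasDerivAt_diskAut hhalf (he z hz)).differentiableAt.comp_differentiableWithinAt z
      (hed z hz)
  · rintro ⟨c, hc⟩
    have h0 : (0 : ℂ) ∈ unitDisk := by simp [unitDisk]
    have h1 : (1 / 2 : ℂ) ∈ unitDisk := mem_ball_zero_iff.2 hhalf
    rw [← himage] at h0 h1
    obtain ⟨x, hx, hx0⟩ := h0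
    obtain ⟨y, hy, hy1⟩ := h1
    have h2 := (hc hx).symm.trans hx0
    have h3 := (hc hy).symm.trans hy1
    rw [h2] at h3
    norm_num at h3
  · intro v _
    obtain ⟨w₁, w₂, -, hw⟩ := exists_factor_blaschke v
    have hsub : unitDisk ∩ φ ⁻¹' {v} ⊆ (unitDisk ∩ e ⁻¹' {w₁}) ∪ (unitDisk ∩ e ⁻¹' {w₂}) := by
      rintro z ⟨hz, hzv⟩
      rcases (hw _ (he z hz)).1 hzv with h | h
      · exact Or.inl ⟨hz, h⟩
      · exact Or.inr ⟨hz, h⟩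
    calc (unitDisk ∩ φ ⁻¹' {v}).encard ≤ _ := encard_le_encard hsub
      _ ≤ _ := encard_union_le _ _
      _ ≤ 2 + 2 := add_le_add (hval_e _) (hval_e _)
      _ = (4 : ℕ) := by norm_num

/-- The `n`-th Taylor coefficient at the origin. -/
def taylorCoeff (g : ℂ → ℂ) (n : ℕ) : ℂ := (n.factorial : ℂ)⁻¹ * iteratedDeriv n g 0

lemma taylorCoeff_pow (m n : ℕ) : taylorCoeff (fun z => z ^ m) n = if n = m then 1 else 0 := by
  rw [taylorCoeff, iteratedDeriv_fun_pow_zero]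
  split_ifs with h
  · subst h
    exact inv_mul_cancel₀ (Nat.cast_ne_zero.2 n.factorial_ne_zero)
  · simp

lemma circleAverage_conj_pow_mul {g : ℂ → ℂ} {r : ℝ} (hr : 0 < r)
    (hg : DifferentiableOn ℂ g (Metric.closedBall 0 r)) (n : ℕ) :
    Real.circleAverage (fun z => (starRingEnd ℂ) z ^ n * g z) 0 r =
      r ^ (2 * n) * taylorCoeff g n := by
  have h1 : EqOn (fun z => (starRingEnd ℂ) z ^ n * g z)
      (fun z => ((r : ℂ) ^ (2 * n)) • ((z ^ n)⁻¹ * g z)) (Metric.sphere 0 |r|) := by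
    intro z hz
    rw [abs_of_pos hr, mem_sphere_zero_iff_norm] at hz
    have hz0 : z ≠ 0 := by
      rintro rfl
      simp [hr.ne] at hz
    have h2 : (r : ℂ) ^ 2 = z * (starRingEnd ℂ) z := by
      rw [Complex.mul_conj, Complex.normSq_eq_norm_sq, hz]
      push_cast
      rfl
    simp only [smul_eq_mul]
    rw [pow_mul, h2, mul_pow]
    field_simp
  have h3 := hg.circleIntegral_one_div_sub_center_pow_smul hr n
  have h4 : (2 * Real.pi * I : ℂ) ≠ 0 := Complex.two_pi_I_ne_zero
  rw [Real.circleAverage_congr_sphere h1, Real.circleAverage_fun_smul,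
    Real.circleAverage_eq_circleIntegral hr.ne', smul_eq_mul, taylorCoeff]
  have h5 : ∀ z : ℂ, (z - 0)⁻¹ • ((z ^ n)⁻¹ * g z) = (1 / (z - 0) ^ (n + 1)) • g z := by
    intro z
    simp only [smul_eq_mul, sub_zero, pow_succ, one_div, mul_inv]
    ring
  simp only [h5]
  rw [h3]
  simp only [smul_eq_mul]
  field_simp

lemma sum_norm_taylorCoeff_le_circleAverage {g : ℂ → ℂ} {r : ℝ} (hr : 0 < r)
    (hg : DifferentiableOn ℂ g (Metric.closedBall 0 r)) (N : ℕ) :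
    ∑ n ∈ Finset.range N, r ^ (2 * n) * ‖taylorCoeff g n‖ ^ 2 ≤
      Real.circleAverage (fun z => ‖g z‖ ^ 2) 0 r := by
  set P : ℂ → ℂ := fun z => ∑ n ∈ Finset.range N, taylorCoeff g n * z ^ n
  have hP : Differentiable ℂ P := by fun_prop
  have hcirc : ∀ {G : ℂ → ℂ}, ContinuousOn G (Metric.sphere 0 r) → CircleIntegrable G 0 r :=
    fun h => h.circleIntegrable hr.le
  have hgc : ContinuousOn g (Metric.sphere 0 r) :=
    hg.continuousOn.mono Metric.sphere_subset_closedBall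
  have hpair : ∀ G : ℂ → ℂ, DifferentiableOn ℂ G (Metric.closedBall 0 r) →
      Real.circleAverage (fun z => (starRingEnd ℂ) (P z) * G z) 0 r =
        ∑ n ∈ Finset.range N, (starRingEnd ℂ) (taylorCoeff g n) *
          (r ^ (2 * n) * taylorCoeff G n) := by
    intro G hG
    have hGc : ContinuousOn G (Metric.sphere 0 r) :=
      hG.continuousOn.mono Metric.sphere_subset_closedBall
    have h1 : (fun z => (starRingEnd ℂ) (P z) * G z) = fun z => ∑ n ∈ Finset.range N,
        (starRingEnd ℂ) (taylorCoeff g n) • ((starRingEnd ℂ) z ^ n * G z) := by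
      ext z
      simp only [P, map_sum, map_mul, map_pow, Finset.sum_mul, smul_eq_mul, mul_assoc]
    rw [h1, Real.circleAverage_fun_sum]
    · refine Finset.sum_congr rfl fun n _ => ?_
      rw [Real.circleAverage_fun_smul, circleAverage_conj_pow_mul hr hG, smul_eq_mul]
    · intro n _
      exact hcirc (by fun_prop)
  have hPcoeff : ∀ n ∈ Finset.range N, taylorCoeff P n = taylorCoeff g n := by
    intro n hn
    have h1 := circleAverage_conj_pow_mul hr hP.differentiableOn n
    have h2 : (fun z => (starRingEnd ℂ) z ^ n * P z) = fun z => ∑ m ∈ Finset.range N,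
        taylorCoeff g m • ((starRingEnd ℂ) z ^ n * z ^ m) := by
      ext z
      simp only [P, Finset.mul_sum, smul_eq_mul]
      exact Finset.sum_congr rfl fun m _ => by ring
    rw [h2, Real.circleAverage_fun_sum] at h1
    · simp only [Real.circleAverage_fun_smul] at h1
      rw [Finset.sum_congr rfl fun m _ => by
        rw [circleAverage_conj_pow_mul hr (g := fun z => z ^ m)
          (Differentiable.differentiableOn (by fun_prop)) n, taylorCoeff_pow]] at h1
      simp only [smul_eq_mul, mul_ite, mul_one, mul_zero, Finset.sum_ite_eq, hn, if_true] at h1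
      have h3 : (r : ℂ) ^ (2 * n) ≠ 0 := pow_ne_zero _ (Complex.ofReal_ne_zero.2 hr.ne')
      exact mul_left_cancel₀ h3 (h1.symm.trans (mul_comm _ _))
    · intro m _
      exact hcirc (by fun_prop)
  set S : ℝ := ∑ n ∈ Finset.range N, r ^ (2 * n) * ‖taylorCoeff g n‖ ^ 2
  have hS : ∑ n ∈ Finset.range N, (starRingEnd ℂ) (taylorCoeff g n) *
      ((r : ℂ) ^ (2 * n) * taylorCoeff g n) = (S : ℂ) := by
    simp only [S]
    push_cast
    refine Finset.sum_congr rfl fun n _ => ?_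
    rw [← Complex.conj_mul']
    ring
  have hg1 := (hpair g hg).trans hS
  have hP1 : Real.circleAverage (fun z => (starRingEnd ℂ) (P z) * P z) 0 r = (S : ℂ) := by
    rw [hpair P hP.differentiableOn, ← hS]
    exact Finset.sum_congr rfl fun n hn => by rw [hPcoeff n hn]
  have hPconj : Continuous fun z => (starRingEnd ℂ) (P z) :=
    Complex.continuous_conj.comp hP.continuous
  have hi1 : CircleIntegrable (fun z => (starRingEnd ℂ) (P z) * g z) 0 r :=
    hcirc (hPconj.continuousOn.mul hgc)
  have hi2 : CircleIntegrable (fun z => (starRingEnd ℂ) (P z) * P z) 0 r :=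
    hcirc (hPconj.mul hP.continuous).continuousOn
  have hi3 : CircleIntegrable (fun z => (2 : ℂ) • ((starRingEnd ℂ) (P z) * g z)) 0 r :=
    hcirc (by fun_prop)
  have hi : CircleIntegrable (fun z => (2 : ℂ) • ((starRingEnd ℂ) (P z) * g z) -
      (starRingEnd ℂ) (P z) * P z) 0 r := hi3.sub hi2
  have havg : Real.circleAverage (Complex.reCLM ∘ fun z => (2 : ℂ) •
      ((starRingEnd ℂ) (P z) * g z) - (starRingEnd ℂ) (P z) * P z) 0 r = S := by
    rw [Complex.reCLM.circleAverage_comp_comm hi, Real.circleAverage_fun_sub hi3 hi2,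
      Real.circleAverage_fun_smul, hg1, hP1]
    simp
    ring
  rw [← havg]
  refine Real.circleAverage_mono ?_ ?_ fun z _ => ?_
  · exact ContinuousOn.circleIntegrable hr.le
      (Complex.continuous_re.comp_continuousOn (by fun_prop))
  · exact ContinuousOn.circleIntegrable hr.le (hgc.norm.pow 2)
  · have h1 := Complex.normSq_nonneg (g z - P z)
    rw [← Complex.normSq_eq_norm_sq]
    simp only [Complex.normSq_apply, Complex.sub_re, Complex.sub_im] at h1
    simp only [Function.comp, Complex.reCLM_apply, Complex.normSq_apply, smul_eq_mul,
      Complex.sub_re, Complex.mul_re, Complex.mul_im, Complex.conj_re, Complex.conj_im]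
    norm_num
    nlinarith

lemma sum_norm_taylorCoeff_le {g : ℂ → ℂ} {K : ℝ} (hg : DifferentiableOn ℂ g unitDisk)
    (hK : ∀ r : ℝ, 0 < r → r < 1 → Real.circleAverage (fun z => ‖g z‖ ^ 2) 0 r ≤ K) (N : ℕ) :
    ∑ n ∈ Finset.range N, ‖taylorCoeff g n‖ ^ 2 ≤ K := by
  have hc : Continuous fun r : ℝ => ∑ n ∈ Finset.range N, r ^ (2 * n) * ‖taylorCoeff g n‖ ^ 2 := by
    fun_prop
  have h1 := (hc.tendsto 1).mono_left (nhdsWithin_le_nhds (s := Iio 1))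
  simp only [one_pow, one_mul] at h1
  refine le_of_tendsto h1 ?_
  filter_upwards [Ioo_mem_nhdsLT (zero_lt_one' ℝ)] with r hr
  refine (sum_norm_taylorCoeff_le_circleAverage hr.1 (hg.mono ?_) N).trans (hK r hr.1 hr.2)
  exact Metric.closedBall_subset_ball hr.2

lemma exists_H2_of_circleAverage_le {g : ℂ → ℂ} {K : ℝ} (hK0 : 0 ≤ K)
    (hg : DifferentiableOn ℂ g unitDisk)
    (hK : ∀ r : ℝ, 0 < r → r < 1 → Real.circleAverage (fun z => ‖g z‖ ^ 2) 0 r ≤ K ^ 2) :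
    ∃ e : H2, ‖e‖ ≤ K ∧ ∀ z ∈ unitDisk, H2.eval e z = g z := by
  have hsum : ∀ s : Finset ℕ, ∑ n ∈ s, ‖taylorCoeff g n‖ ^ (2 : ℝ≥0∞).toReal ≤ K ^ 2 := by
    intro s
    obtain ⟨N, hN⟩ := s.exists_nat_subset_range
    simp only [ENNReal.toReal_ofNat, Real.rpow_ofNat]
    exact (Finset.sum_le_sum_of_subset_of_nonneg hN fun _ _ _ => by positivity).trans
      (sum_norm_taylorCoeff_le hg hK N)
  refine ⟨⟨taylorCoeff g, memℓp_gen' hsum⟩, ?_, fun z hz => ?_⟩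
  · refine lp.norm_le_of_forall_sum_le (by simp) hK0 fun s => (hsum s).trans_eq ?_
    simp
  · have h1 := Complex.taylorSeries_eq_on_ball' hz hg
    simpa only [H2.eval, taylorCoeff, sub_zero] using h1

/-- A continuous function on the half-line with prescribed growth at the origin. -/
lemma exists_continuousOn_forall_le {h A : ℕ → ℝ} (hh : ∀ k, 0 < h k)
    (hlim : Tendsto h atTop (𝓝 0)) (hA : ∀ k, 0 ≤ A k) :
    ∃ ψ : ℝ → ℝ, ContinuousOn ψ (Ioi 0) ∧ (∀ x, 0 < ψ x) ∧
      ∀ k x, 0 < x → x ≤ h k → A k ≤ ψ x := by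
  set t : ℕ → ℝ → ℝ := fun k x => A k * max 0 (2 - x / h k)
  have ht : ∀ k x, 0 ≤ t k x := fun k x => mul_nonneg (hA k) (le_max_left _ _)
  have hfin : ∀ δ > 0, ∃ K : ℕ, ∀ x, δ ≤ x → ∀ k ∉ Finset.range K, t k x = 0 := by
    intro δ hδ
    obtain ⟨K, hK⟩ := eventually_atTop.1 (hlim.eventually (gt_mem_nhds (half_pos hδ)))
    refine ⟨K, fun x hx k hk => ?_⟩
    have h1 := hK k (by simpa using hk)
    have h2 : 2 ≤ x / h k := by
      rw [le_div_iff₀ (hh k)]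
      linarith
    simp only [t]
    rw [max_eq_left (by linarith), mul_zero]
  refine ⟨fun x => 1 + ∑' k, t k x, fun x hx => ?_, fun x => ?_, fun k x hx hxk => ?_⟩
  · obtain ⟨K, hK⟩ := hfin (x / 2) (half_pos hx)
    have h1 : (fun y => 1 + ∑' k, t k y) =ᶠ[𝓝 x] fun y => 1 + ∑ k ∈ Finset.range K, t k y := by
      filter_upwards [lt_mem_nhds (half_lt_self hx)] with y hy
      rw [tsum_eq_sum (hK y hy.le)]
    have h2 : Continuous fun y => 1 + ∑ k ∈ Finset.range K, t k y := by fun_prop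
    exact (h2.continuousAt.congr h1.symm).continuousWithinAt
  · have h1 : 0 ≤ ∑' k, t k x := tsum_nonneg fun k => ht k x
    linarith
  · obtain ⟨K, hK⟩ := hfin x hx
    have h1 : A k * 1 ≤ t k x := by
      refine mul_le_mul_of_nonneg_left (le_max_of_le_right ?_) (hA k)
      have := (div_le_one (hh k)).2 hxk
      linarith
    have hs : Summable fun k => t k x := summable_of_ne_finset_zero (hK x le_rfl)
    have h2 := hs.le_tsum k fun j _ => ht j x
    linarith

lemma circleAverage_norm_pow_sq_le {φ f : ℂ → ℂ} (hφd : DifferentiableOn ℂ φ unitDisk)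
    (hfd : DifferentiableOn ℂ f unitDisk)
    (hφ : ∀ z ∈ unitDisk, ‖φ z‖ ≤ Real.exp (-(f z).re))
    {h A : ℝ} (hA : 0 < A) (hre : ∀ z ∈ unitDisk, 0 < (f z).re)
    (him : ∀ z ∈ unitDisk, 0 < (f z).im)
    (hf : ∀ z ∈ unitDisk, (f z).re ≤ h → A ≤ (f z).im) (k : ℕ) {r : ℝ} (hr0 : 0 < r)
    (hr1 : r < 1) :
    Real.circleAverage (fun z => ‖φ z ^ k‖ ^ 2) 0 r ≤
      Real.exp (-(2 * (k * h))) + (f 0).im / A := by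
  have hsub : Metric.closedBall (0 : ℂ) r ⊆ unitDisk := Metric.closedBall_subset_ball hr1
  have hsub' : Metric.sphere (0 : ℂ) r ⊆ unitDisk := Metric.sphere_subset_closedBall.trans hsub
  have hfc : ContinuousOn f (Metric.sphere 0 r) := hfd.continuousOn.mono hsub'
  have hφc : ContinuousOn φ (Metric.sphere 0 r) := hφd.continuousOn.mono hsub'
  have hfi : CircleIntegrable f 0 r := hfc.circleIntegrable hr0.le
  have hmean : Real.circleAverage (Complex.imCLM ∘ f) 0 r = (f 0).im := by
    rw [Complex.imCLM.circleAverage_comp_comm hfi, DiffContOnCl.circleAverage]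
    · rfl
    · rw [abs_of_pos hr0]
      exact (hfd.mono (Metric.closure_ball_subset_closedBall.trans hsub)).diffContOnCl
  have hi : CircleIntegrable (fun z => A⁻¹ • (Complex.imCLM ∘ f) z) 0 r :=
    (ContinuousOn.circleIntegrable hr0.le
      (((Complex.imCLM.continuous.comp_continuousOn hfc)).const_smul A⁻¹))
  have h1 : Real.circleAverage (fun z => Real.exp (-(2 * (k * h))) +
      A⁻¹ • (Complex.imCLM ∘ f) z) 0 r = Real.exp (-(2 * (k * h))) + (f 0).im / A := by
    rw [Real.circleAverage_fun_add (circleIntegrable_const _ _ _) hi, Real.circleAverage_const,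
      Real.circleAverage_fun_smul, hmean, smul_eq_mul, div_eq_inv_mul]
  rw [← h1]
  refine Real.circleAverage_mono (ContinuousOn.circleIntegrable hr0.le (by fun_prop))
    ((circleIntegrable_const _ _ _).add hi) fun z hz => ?_
  rw [abs_of_pos hr0] at hz
  have hz' := hsub' hz
  have h2 : ‖φ z ^ k‖ ^ 2 ≤ Real.exp (-(2 * (k * (f z).re))) := by
    calc ‖φ z ^ k‖ ^ 2 = (‖φ z‖ ^ k) ^ 2 := by rw [norm_pow]
      _ ≤ (Real.exp (-(f z).re) ^ k) ^ 2 := by gcongr; exact hφ z hz'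
      _ = Real.exp (-(2 * (k * (f z).re))) := by
        rw [← Real.exp_nat_mul, ← Real.exp_nat_mul]
        congr 1
        push_cast
        ring
  have h3 : (0 : ℝ) ≤ A⁻¹ • (Complex.imCLM ∘ f) z :=
    mul_nonneg (inv_nonneg.2 hA.le) (him z hz').le
  have hk : (0 : ℝ) ≤ k := k.cast_nonneg
  rcases le_total (f z).re h with hle | hle
  · have h4 : 1 ≤ A⁻¹ • (Complex.imCLM ∘ f) z := by
      rw [smul_eq_mul, ← div_eq_inv_mul, one_le_div hA]
      exact hf z hz' hle
    have h5 : Real.exp (-(2 * (k * (f z).re))) ≤ 1 :=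
      Real.exp_le_one_iff.2 (neg_nonpos.2 (by have := hre z hz'; positivity))
    have h6 := Real.exp_pos (-(2 * (k * h)))
    linarith
  · have h4 : Real.exp (-(2 * (k * (f z).re))) ≤ Real.exp (-(2 * (k * h))) := by gcongr
    linarith

lemma exists_fourValent_symbol_pow_le {b : ℕ → ℝ} (hb : ∀ k, 0 < b k)
    (hlim : Tendsto (fun k => b k / k) atTop (𝓝 0)) :
    ∃ φ : ℂ → ℂ, IsSymbol φ ∧ φ '' unitDisk = unitDisk ∧ Valent φ 4 ∧ ∃ C > 0,
      ∀ (k : ℕ) (r : ℝ), 0 < r → r < 1 →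
        Real.circleAverage (fun z => ‖φ z ^ k‖ ^ 2) 0 r ≤ (C * Real.exp (-b k)) ^ 2 := by
  obtain ⟨ψ, hψc, hψ0, hψ⟩ := exists_continuousOn_forall_le
    (h := fun k => b (k + 1) / (k + 1 : ℕ)) (A := fun k => Real.exp (2 * b (k + 1)))
    (fun k => div_pos (hb _) (by positivity)) ((tendsto_add_atTop_iff_nat 1).2 hlim)
    fun k => (Real.exp_pos _).le
  obtain ⟨φ, f, hsym, himg, hval, hfd, hf⟩ := exists_fourValent_symbol hψc
  have him : ∀ z ∈ unitDisk, 0 < (f z).im := fun z hz => (hψ0 _).trans (hf z hz).2.1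
  have him0 : 0 < (f 0).im := him 0 (by simp [unitDisk])
  refine ⟨φ, hsym, himg, hval, (1 + (f 0).im) * Real.exp (b 0), by positivity, ?_⟩
  intro k r hr0 hr1
  rcases k with _ | k
  · simp only [pow_zero, norm_one, one_pow, Real.circleAverage_const]
    rw [mul_assoc, ← Real.exp_add, add_neg_cancel, Real.exp_zero, mul_one]
    nlinarith
  refine (circleAverage_norm_pow_sq_le hsym.diff hfd (fun z hz => (hf z hz).2.2)
    (Real.exp_pos (2 * b (k + 1))) (fun z hz => (hf z hz).1) him
    (h := b (k + 1) / (k + 1 : ℕ)) (fun z hz hle => ?_) (k + 1) hr0 hr1).trans ?_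
  · exact (hψ k _ (hf z hz).1 hle).trans (hf z hz).2.1.le
  · rw [mul_div_cancel₀ _ (by positivity), div_eq_mul_inv, ← Real.exp_neg, mul_pow,
      ← Real.exp_nat_mul]
    have h1 : 1 + (f 0).im ≤ ((1 + (f 0).im) * Real.exp (b 0)) ^ 2 := by
      have := Real.one_le_exp (hb 0).le
      have h2 : 1 + (f 0).im ≤ (1 + (f 0).im) * Real.exp (b 0) :=
        le_mul_of_one_le_right (by linarith) this
      nlinarith
    have h2 : ((2 : ℕ) : ℝ) * -b (k + 1) = -(2 * b (k + 1)) := by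
      push_cast
      ring
    rw [h2]
    have h3 := mul_le_mul_of_nonneg_right h1 (Real.exp_pos (-(2 * b (k + 1)))).le
    linarith

/-- The coordinate functionals of `H²`. -/
abbrev H2.coord (k : ℕ) : H2 →L[ℂ] ℂ := lp.evalCLM ℂ (fun _ : ℕ => ℂ) 2 k

lemma H2.norm_coord_le (k : ℕ) : ‖H2.coord k‖ ≤ 1 :=
  ContinuousLinearMap.opNorm_le_bound _ zero_le_one fun a => by
    rw [one_mul]
    exact lp.norm_apply_le_norm two_ne_zero a k

lemma H2.exists_eval_eq {z : ℂ} (hz : z ∈ unitDisk) :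
    ∃ L : H2 →L[ℂ] ℂ, ∀ a : H2, H2.eval a z = L a := by
  have hz1 : ‖z‖ < 1 := mem_ball_zero_iff.1 hz
  have hs : Summable fun n => z ^ n • H2.coord n := by
    refine Summable.of_norm_bounded (summable_geometric_of_lt_one (norm_nonneg z) hz1) fun n => ?_
    rw [norm_smul, norm_pow]
    exact mul_le_of_le_one_right (by positivity) (H2.norm_coord_le n)
  refine ⟨∑' n, z ^ n • H2.coord n, fun a => ?_⟩
  have h1 := (ContinuousLinearMap.apply ℂ ℂ a).hasSum hs.hasSum
  rw [H2.eval, ← ContinuousLinearMap.apply_apply a (∑' n, z ^ n • H2.coord n), ← h1.tsum_eq]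
  exact tsum_congr fun n => mul_comm _ _

lemma exists_isCompOp_approxNum_le {φ : ℂ → ℂ} {e : ℕ → H2}
    (he : ∀ k, ∀ z ∈ unitDisk, H2.eval (e k) z = φ z ^ k) (hs : Summable fun k => ‖e k‖) :
    ∃ T : H2 →L[ℂ] H2, IsCompOp φ T ∧
      ∀ n : ℕ, approxNum (n + 1) T ≤ ∑' k, ‖e (k + n)‖ := by
  have hle : ∀ k, ‖(H2.coord k).smulRight (e k)‖ ≤ ‖e k‖ := by
    intro k
    rw [ContinuousLinearMap.norm_smulRight_apply]
    exact mul_le_of_le_one_left (norm_nonneg _) (H2.norm_coord_le k)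
  have hT : Summable fun k => (H2.coord k).smulRight (e k) := Summable.of_norm_bounded hs hle
  refine ⟨∑' k, (H2.coord k).smulRight (e k), fun a z hz => ?_, fun n => ?_⟩
  · obtain ⟨L, hL⟩ := H2.exists_eval_eq hz
    have h1 := (L.comp (ContinuousLinearMap.apply ℂ H2 a)).hasSum hT.hasSum
    rw [hL, H2.eval]
    refine h1.tsum_eq.symm.trans (tsum_congr fun k => ?_)
    change L (a k • e k) = _
    rw [map_smul, ← hL, he k z hz, smul_eq_mul]
  · set R : H2 →L[ℂ] H2 := ∑ k ∈ Finset.range n, (H2.coord k).smulRight (e k)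
    have hrank : Module.rank ℂ (LinearMap.range (R : H2 →ₗ[ℂ] H2)) < ((n + 1 : ℕ) : Cardinal) := by
      classical
      have h1 : LinearMap.range (R : H2 →ₗ[ℂ] H2) ≤
          Submodule.span ℂ ((Finset.range n).image e : Set H2) := by
        rintro _ ⟨a, rfl⟩
        have h2 : (R : H2 →ₗ[ℂ] H2) a = ∑ k ∈ Finset.range n, a k • e k := by
          simp only [R, ContinuousLinearMap.coe_coe, sum_apply,
            ContinuousLinearMap.smulRight_apply]
          rfl
        rw [h2]
        refine Submodule.sum_mem _ fun k hk => Submodule.smul_mem _ _ (Submodule.subset_span ?_)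
        exact Finset.mem_coe.2 (Finset.mem_image_of_mem e hk)
      refine (Submodule.rank_mono h1).trans_lt ((rank_span_finset_le _).trans_lt ?_)
      exact_mod_cast Nat.lt_succ_of_le (Finset.card_image_le.trans_eq (Finset.card_range n))
    have hbdd : BddBelow {c : ℝ | ∃ R : H2 →L[ℂ] H2, Module.rank ℂ
        (LinearMap.range (R : H2 →ₗ[ℂ] H2)) < ((n + 1 : ℕ) : Cardinal) ∧
          c = ‖∑' k, (H2.coord k).smulRight (e k) - R‖} :=
      ⟨0, by rintro _ ⟨R, -, rfl⟩; exact norm_nonneg _⟩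
    refine (csInf_le hbdd ⟨R, hrank, rfl⟩).trans ?_
    rw [← hT.sum_add_tsum_nat_add n, add_sub_cancel_left]
    exact tsum_of_norm_bounded ((summable_nat_add_iff n).2 hs).hasSum fun k => hle (k + n)

lemma tendsto_partialSups_div {u : ℕ → ℝ} (hu0 : ∀ n, 0 ≤ u n)
    (hu : Tendsto (fun n => u n / n) atTop (𝓝 0)) :
    Tendsto (fun n => partialSups u n / n) atTop (𝓝 0) := by
  rw [Metric.tendsto_atTop] at hu ⊢
  intro δ hδ
  obtain ⟨M, hM⟩ := hu (δ / 2) (half_pos hδ)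
  obtain ⟨N, hN⟩ := exists_nat_gt (partialSups u M / (δ / 2))
  refine ⟨N + 1, fun n hn => ?_⟩
  have hn1 : (N : ℝ) + 1 ≤ n := by exact_mod_cast hn
  have hn0 : (0 : ℝ) < n := by
    have : (0 : ℝ) ≤ N := N.cast_nonneg
    linarith
  have h0 : 0 ≤ partialSups u n := (hu0 0).trans (le_partialSups_of_le u n.zero_le)
  rw [Real.dist_0_eq_abs, abs_of_nonneg (div_nonneg h0 hn0.le), div_lt_iff₀ hn0]
  have h1 : partialSups u n ≤ δ / 2 * n := by
    refine partialSups_le u n _ fun m hm => ?_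
    rcases le_total m M with h | h
    · rw [div_lt_iff₀ (half_pos hδ)] at hN
      have := le_partialSups_of_le u h
      nlinarith
    · rcases m.eq_zero_or_pos with rfl | hm0
      · obtain rfl : M = 0 := by omega
        rw [div_lt_iff₀ (half_pos hδ)] at hN
        have := le_partialSups u 0
        nlinarith
      have hm0' : (0 : ℝ) < m := by exact_mod_cast hm0
      have h2 := hM m h
      rw [Real.dist_0_eq_abs, abs_of_nonneg (div_nonneg (hu0 m) hm0'.le), div_lt_iff₀ hm0'] at h2
      have h3 : (m : ℝ) ≤ n := by exact_mod_cast hm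
      nlinarith
  nlinarith

lemma exists_sublinear_exp_neg_le {ε : ℕ → ℝ} (hε : ∀ n, 0 < ε n)
    (hlim : Tendsto ε atTop (𝓝 0)) :
    ∃ b : ℕ → ℝ, (∀ k, 0 < b k) ∧ Tendsto (fun k => b k / k) atTop (𝓝 0) ∧
      ∀ n k : ℕ, n ≤ k → Real.exp (-b k) ≤
        Real.exp (-((n + 1 : ℕ) : ℝ) * ε (n + 1)) * (1 / ((k : ℝ) + 1) ^ 2) := by
  set u : ℕ → ℝ := fun n => n * ε n
  have hu0 : ∀ n, 0 ≤ u n := fun n => mul_nonneg n.cast_nonneg (hε n).le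
  have hu : Tendsto (fun n => u n / n) atTop (𝓝 0) := by
    refine hlim.congr' ?_
    filter_upwards [eventually_gt_atTop 0] with n hn
    have : (n : ℝ) ≠ 0 := by exact_mod_cast hn.ne'
    simp only [u]
    field_simp
  set a : ℕ → ℝ := fun m => partialSups u m + 2 * Real.log m
  have ha : Tendsto (fun m => a m / m) atTop (𝓝 0) := by
    have h1 : Tendsto (fun m : ℕ => Real.log m / m) atTop (𝓝 0) :=
      (Real.isLittleO_log_id_atTop.tendsto_div_nhds_zero).comp tendsto_natCast_atTop_atTop
    have h2 := (tendsto_partialSups_div hu0 hu).add (h1.const_mul 2)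
    rw [mul_zero, add_zero] at h2
    refine h2.congr fun m => ?_
    simp only [a]
    ring
  refine ⟨fun k => a (k + 1), fun k => ?_, ?_, fun n k hnk => ?_⟩
  · have h1 : u 1 ≤ partialSups u (k + 1) := le_partialSups_of_le u (by omega)
    have h2 : 0 < u 1 := by simpa [u] using hε 1
    have h3 : 0 ≤ Real.log (k + 1 : ℕ) := Real.log_natCast_nonneg _
    simp only [a]
    linarith
  · have h1 := (tendsto_add_atTop_iff_nat 1).2 ha
    have h2 : Tendsto (fun k : ℕ => 1 + 1 / (k : ℝ)) atTop (𝓝 (1 + 0)) :=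
      tendsto_const_nhds.add tendsto_one_div_atTop_nhds_zero_nat
    have h3 := h1.mul h2
    rw [zero_mul] at h3
    refine h3.congr' ?_
    filter_upwards [eventually_gt_atTop 0] with k hk
    have : (k : ℝ) ≠ 0 := by exact_mod_cast hk.ne'
    have : (k : ℝ) + 1 ≠ 0 := by positivity
    push_cast
    field_simp
  · have h1 : u (n + 1) ≤ partialSups u (k + 1) := le_partialSups_of_le u (by omega)
    have h2 : (0 : ℝ) < (k : ℝ) + 1 := by positivity
    have h3 : Real.exp (-(2 * Real.log ((k : ℝ) + 1))) = 1 / ((k : ℝ) + 1) ^ 2 := by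
      rw [Real.exp_neg, one_div, ← Real.log_rpow h2, Real.exp_log (by positivity), Real.rpow_two]
    rw [← h3, ← Real.exp_add, Real.exp_le_exp]
    simp only [a]
    push_cast
    simp only [u] at h1
    push_cast at h1
    linarith

/-- for every sequence of positive numbers `ε_n → 0` there is a
surjective four-valent symbol `φ` with `a_n(C_φ) ≤ C e^{-n ε_n}`. -/
theorem stmt_12 (ε : ℕ → ℝ) (hε : ∀ n, 0 < ε n)
    (hlim : Filter.Tendsto ε Filter.atTop (nhds 0)) :
    ∃ φ : ℂ → ℂ, IsSymbol φ ∧ φ '' unitDisk = unitDisk ∧ Valent φ 4 ∧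
      ∃ T : H2 →L[ℂ] H2, IsCompOp φ T ∧
        ∃ C > (0 : ℝ), ∀ n : ℕ, 1 ≤ n →
          approxNum n T ≤ C * Real.exp (-(n : ℝ) * ε n) := by
  obtain ⟨b, hb0, hb, hbexp⟩ := exists_sublinear_exp_neg_le hε hlim
  obtain ⟨φ, hsym, himg, hval, C, hC, hφ⟩ := exists_fourValent_symbol_pow_le hb0 hb
  choose e henorm he using fun k => exists_H2_of_circleAverage_le
    (mul_nonneg hC.le (Real.exp_pos (-b k)).le) (hsym.diff.pow k) (hφ k)
  have hq : Summable fun k : ℕ => 1 / ((k : ℝ) + 1) ^ 2 := by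
    simpa using (summable_nat_add_iff 1).2 (Real.summable_one_div_nat_pow.2 one_lt_two)
  have hbound : ∀ n k : ℕ, ‖e (k + n)‖ ≤
      C * Real.exp (-((n + 1 : ℕ) : ℝ) * ε (n + 1)) * (1 / ((k : ℝ) + 1) ^ 2) := by
    intro n k
    refine (henorm (k + n)).trans ?_
    rw [mul_assoc]
    refine mul_le_mul_of_nonneg_left ((hbexp n (k + n) (by omega)).trans ?_) hC.le
    gcongr
    omega
  have hs : Summable fun k => ‖e k‖ := by
    refine Summable.of_nonneg_of_le (fun _ => norm_nonneg _) (fun k => hbound 0 k) ?_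
    exact hq.mul_left _
  obtain ⟨T, hT, hTn⟩ := exists_isCompOp_approxNum_le he hs
  refine ⟨φ, hsym, himg, hval, T, hT, C * ∑' k : ℕ, 1 / ((k : ℝ) + 1) ^ 2, ?_, ?_⟩
  · exact mul_pos hC (hq.tsum_pos (fun _ => by positivity) 0 (by positivity))
  · intro n hn
    obtain ⟨n, rfl⟩ := Nat.exists_eq_add_of_le' hn
    refine (hTn n).trans ((((summable_nat_add_iff n).2 hs).tsum_le_tsum (hbound n)
      (hq.mul_left _)).trans_eq ?_)
    rw [tsum_mul_left]
    ring

end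
end

section
/- There exists a numerical constant C > 0 with the following property: if f is holomorphic on D and α ∈ ℝ are such that Im f(0) < α and f(D) ⊆ {z ∈ ℂ : 0 < Re z < π} ∪ {z ∈ ℂ : Im z < α}, then for every y ≥ α, m({ξ ∈ T : the radial limit f*(ξ) = lim_{r→1⁻} f(rξ) exists and Im f*(ξ) > y}) ≤ C e^{α − y}. -/
open Complex MeasureTheory Set Filter
open scoped ENNReal Topology

noncomputable section

lemma mul_toCircle_mem_unitDisk {r : ℝ} (hr : r ∈ Ioo 0 1) (θ : AddCircle (1 : ℝ)) :
    (r : ℂ) * (AddCircle.toCircle θ : ℂ) ∈ unitDisk := by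
  rw [unitDisk, mem_ball_zero_iff, norm_mul, Circle.norm_coe, mul_one, norm_real,
    Real.norm_of_nonneg hr.1.le]
  exact hr.2

/-- Mean value property on the circle of radius `r < 1`, over the circle of unit length. -/
lemma integral_re_toCircle {g : ℂ → ℂ} (hg : DifferentiableOn ℂ g unitDisk) {r : ℝ}
    (hr₀ : 0 ≤ r) (hr₁ : r < 1) :
    ∫ θ : AddCircle (1 : ℝ), (g (r * (AddCircle.toCircle θ : ℂ))).re = (g 0).re := by
  have hsub : Metric.closedBall (0 : ℂ) |r| ⊆ unitDisk := by
    rw [abs_of_nonneg hr₀]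
    exact Metric.closedBall_subset_ball hr₁
  have hcont : Continuous fun t : ℝ => g (circleMap 0 r t) :=
    hg.continuousOn.comp_continuous (continuous_circleMap 0 r) fun t =>
      hsub (Metric.sphere_subset_closedBall (by simp))
  have hmean : Real.circleAverage g 0 r = g 0 :=
    circleAverage_of_differentiable_on_off_countable countable_empty (hg.continuousOn.mono hsub)
      fun z hz => hg.differentiableAt
        (Metric.isOpen_ball.mem_nhds (hsub (Metric.ball_subset_closedBall hz.1)))
  rw [← AddCircle.intervalIntegral_preimage 1 0, zero_add]
  have hscale := intervalIntegral.integral_comp_mul_left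
    (fun t : ℝ => (g (circleMap 0 r t)).re) (a := 0) (b := 1) (c := 2 * Real.pi) (by positivity)
  have hre : ∫ t in (0 : ℝ)..(2 * Real.pi), (g (circleMap 0 r t)).re =
      (∫ t in (0 : ℝ)..(2 * Real.pi), g (circleMap 0 r t)).re :=
    reCLM.intervalIntegral_comp_comm (hcont.intervalIntegrable _ _)
  calc ∫ t in (0 : ℝ)..1, (g (r * (AddCircle.toCircle (t : AddCircle (1 : ℝ)) : ℂ))).re
      = ∫ t in (0 : ℝ)..1, (g (circleMap 0 r (2 * Real.pi * t))).re := by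
        simp [AddCircle.toCircle_apply_mk, circleMap, Circle.coe_exp]
    _ = (g 0).re := by
        rw [hscale, mul_zero, mul_one, hre, ← hmean, Real.circleAverage_def, smul_eq_mul,
          real_smul, re_ofReal_mul]

/-- A holomorphic function on the disk with nonnegative real part satisfies Markov's inequality
along almost every radius. -/
lemma volume_eventually_le_re {g : ℂ → ℂ} (hg : DifferentiableOn ℂ g unitDisk)
    (hpos : ∀ z ∈ unitDisk, 0 ≤ (g z).re) {c : ℝ} (hc : 0 < c) :
    volume {θ : AddCircle (1 : ℝ) |
      ∀ᶠ r : ℝ in 𝓝[<] 1, c ≤ (g (r * (AddCircle.toCircle θ : ℂ))).re} ≤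
      ENNReal.ofReal ((g 0).re / c) := by
  obtain ⟨u, -, hu, hlim⟩ := exists_seq_strictMono_tendsto' (zero_lt_one' ℝ)
  have hlim' : Tendsto u atTop (𝓝[<] 1) :=
    tendsto_nhdsWithin_iff.2 ⟨hlim, Eventually.of_forall fun n => (hu n).2⟩
  set E : ℕ → Set (AddCircle (1 : ℝ)) :=
    fun n => {θ | c ≤ (g (u n * (AddCircle.toCircle θ : ℂ))).re}
  have hmem (n : ℕ) := mul_toCircle_mem_unitDisk (hu n)
  have hE (n : ℕ) : volume (E n) ≤ ENNReal.ofReal ((g 0).re / c) := by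
    have hcont : Continuous fun θ : AddCircle (1 : ℝ) =>
        (g (u n * (AddCircle.toCircle θ : ℂ))).re :=
      continuous_re.comp (hg.continuousOn.comp_continuous
        (continuous_const.mul (continuous_subtype_val.comp AddCircle.continuous_toCircle))
        (hmem n))
    have hint : Integrable (fun θ : AddCircle (1 : ℝ) =>
        (g (u n * (AddCircle.toCircle θ : ℂ))).re) volume :=
      hcont.integrable_of_hasCompactSupport (HasCompactSupport.of_compactSpace _)
    have hmarkov := mul_meas_ge_le_integral_of_nonneg
      (Eventually.of_forall fun θ => hpos _ (hmem n θ)) hint c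
    rw [integral_re_toCircle hg (hu n).1.le (hu n).2] at hmarkov
    rw [← ofReal_measureReal]
    exact ENNReal.ofReal_le_ofReal ((le_div_iff₀' hc).2 hmarkov)
  have hsub : {θ : AddCircle (1 : ℝ) |
      ∀ᶠ r : ℝ in 𝓝[<] 1, c ≤ (g (r * (AddCircle.toCircle θ : ℂ))).re} ⊆
      ⋃ N, ⋂ n ≥ N, E n := by
    intro θ hθ
    obtain ⟨N, hN⟩ := eventually_atTop.1 (hlim'.eventually hθ)
    exact mem_iUnion.2 ⟨N, mem_iInter₂.2 hN⟩
  have hmono : Monotone fun N => ⋂ n ≥ N, E n := fun M N hMN =>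
    biInter_subset_biInter_left fun n hn => hMN.trans hn
  refine (measure_mono hsub).trans ?_
  rw [hmono.measure_iUnion]
  exact iSup_le fun N => (measure_mono (biInter_subset_of_mem le_rfl)).trans (hE N)

/-- Weak-type estimate of Kolmogorov for holomorphic functions with nonnegative real part. -/
lemma volume_eventually_le_norm {F : ℂ → ℂ} (hF : DifferentiableOn ℂ F unitDisk)
    (hpos : ∀ z ∈ unitDisk, 0 ≤ (F z).re) {t : ℝ} (ht : 0 < t) :
    volume {θ : AddCircle (1 : ℝ) |
      ∀ᶠ r : ℝ in 𝓝[<] 1, t ≤ ‖F (r * (AddCircle.toCircle θ : ℂ))‖ ∧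
        0 ≤ (F (r * (AddCircle.toCircle θ : ℂ))).re} ≤
      ENNReal.ofReal (2 * ‖F 0‖ / t) := by
  have hlow {w : ℂ} (hw : 0 ≤ w.re) : t ≤ ‖w + t‖ := by
    refine le_trans ?_ (re_le_norm _)
    simpa using hw
  have hne {w : ℂ} (hw : 0 ≤ w.re) : w + t ≠ 0 := norm_pos_iff.1 (ht.trans_le (hlow hw))
  have hre (w : ℂ) : (w / (w + t)).re = (w.re ^ 2 + w.im ^ 2 + t * w.re) / normSq (w + t) := by
    simp only [div_re, add_re, ofReal_re, add_im, ofReal_im, add_zero]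
    ring
  have hdiff : DifferentiableOn ℂ (fun z => F z / (F z + t)) unitDisk :=
    hF.div (hF.add_const _) fun z hz => hne (hpos z hz)
  have h0 : (0 : ℂ) ∈ unitDisk := by simp [unitDisk]
  have hmain := volume_eventually_le_re hdiff (fun z hz => by
    have := hpos z hz
    rw [hre]
    have := normSq_nonneg (F z + t)
    positivity) (c := 1 / 2) (by norm_num)
  refine (measure_mono ?_).trans (hmain.trans (ENNReal.ofReal_le_ofReal ?_))
  · intro θ hθ
    rw [mem_ofPred_eq] at hθ ⊢
    filter_upwards [hθ] with r hr
    generalize F (r * (AddCircle.toCircle θ : ℂ)) = w at hr ⊢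
    obtain ⟨hw, hw'⟩ := hr
    have hsq : t ^ 2 ≤ w.re ^ 2 + w.im ^ 2 := by
      have := pow_le_pow_left₀ ht.le hw 2
      rwa [Complex.sq_norm, normSq_apply, ← sq, ← sq] at this
    rw [hre, le_div_iff₀ (normSq_pos.2 (hne hw')), normSq_apply]
    simp only [add_re, ofReal_re, add_im, ofReal_im, add_zero]
    nlinarith [mul_nonneg ht.le hw']
  · have hle : (F 0 / (F 0 + t)).re ≤ ‖F 0‖ / t :=
      (re_le_norm _).trans (by
        rw [norm_div]
        exact div_le_div_of_nonneg_left (norm_nonneg _) ht (hlow (hpos 0 h0)))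
    calc (F 0 / (F 0 + t)).re / (1 / 2) ≤ ‖F 0‖ / t / (1 / 2) := by gcongr
      _ = 2 * ‖F 0‖ / t := by ring

lemma norm_I_mul_exp (w : ℂ) (α : ℝ) :
    ‖I * exp (-I * (w - α * I))‖ = Real.exp (w.im - α) := by
  simp [norm_exp]

lemma re_I_mul_exp (w : ℂ) (α : ℝ) :
    (I * exp (-I * (w - α * I))).re = Real.exp (w.im - α) * Real.sin w.re := by
  simp [exp_im]

/-- there is a numerical constant `C > 0` such that if `f` is holomorphic
on `𝔻` with `Im f(0) < α` and `f(𝔻) ⊆ {0 < Re z < π} ∪ {Im z < α}`, then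
`m({Im f* > y}) ≤ C e^{α - y}` for all `y ≥ α`. -/
theorem stmt_13 :
    ∃ C > (0 : ℝ), ∀ f : ℂ → ℂ, DifferentiableOn ℂ f unitDisk → ∀ α : ℝ,
      (f 0).im < α →
      f '' unitDisk ⊆ {z : ℂ | 0 < z.re ∧ z.re < Real.pi} ∪ {z : ℂ | z.im < α} →
      ∀ y : ℝ, α ≤ y →
        volume {θ : AddCircle (1 : ℝ) | ∃ w : ℂ, HasRadialLimit f θ w ∧ y < w.im}
          ≤ ENNReal.ofReal (C * Real.exp (α - y)) := by
  refine ⟨4, by norm_num, fun f hf α h0 hmaps y hy => ?_⟩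
  set F : ℂ → ℂ := fun z => 1 + I * exp (-I * (f z - α * I)) with hF
  have hdiff : DifferentiableOn ℂ F unitDisk :=
    (((hf.sub_const _).const_mul _).cexp.const_mul _).const_add _
  have hstrip {z : ℂ} (hz : z ∈ unitDisk) (h : α ≤ (f z).im) :
      0 ≤ (I * exp (-I * (f z - α * I))).re := by
    rcases hmaps (mem_image_of_mem f hz) with h' | h'
    · rw [re_I_mul_exp]
      exact mul_nonneg (Real.exp_pos _).le (Real.sin_nonneg_of_nonneg_of_le_pi h'.1.le h'.2.le)
    · exact absurd h (not_le.2 h')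
  have hsmall {z : ℂ} (h : (f z).im < α) : ‖I * exp (-I * (f z - α * I))‖ ≤ 1 := by
    rw [norm_I_mul_exp]
    exact Real.exp_le_one_iff.2 (by linarith)
  have hpos : ∀ z ∈ unitDisk, 0 ≤ (F z).re := by
    intro z hz
    simp only [hF, add_re, one_re]
    rcases le_or_gt α (f z).im with h | h
    · linarith [hstrip hz h]
    · linarith [neg_abs_le (I * exp (-I * (f z - α * I))).re, hsmall h,
        abs_re_le_norm (I * exp (-I * (f z - α * I)))]
  have hF0 : ‖F 0‖ ≤ 2 := by
    have := norm_add_le 1 (I * exp (-I * (f 0 - α * I)))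
    rw [norm_one] at this
    linarith [hsmall h0]
  refine (measure_mono ?_).trans
    ((volume_eventually_le_norm hdiff hpos (Real.exp_pos (y - α))).trans
      (ENNReal.ofReal_le_ofReal ?_))
  · rintro θ ⟨w, hw, hyw⟩
    have him : ∀ᶠ r : ℝ in 𝓝[<] 1, y < (f (r * (AddCircle.toCircle θ : ℂ))).im :=
      ((continuous_im.tendsto w).comp hw).eventually (lt_mem_nhds hyw)
    filter_upwards [him, Ioo_mem_nhdsLT (zero_lt_one' ℝ)] with r hr hr'
    have hz := mul_toCircle_mem_unitDisk hr' θ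
    refine ⟨?_, hpos _ hz⟩
    have hre := hstrip hz (hy.trans hr.le)
    have hnorm := norm_I_mul_exp (f (r * (AddCircle.toCircle θ : ℂ))) α
    simp only [hF]
    generalize I * exp (-I * (f (r * (AddCircle.toCircle θ : ℂ)) - α * I)) = v at hre hnorm ⊢
    calc Real.exp (y - α) ≤ ‖v‖ := by
          rw [hnorm]
          exact Real.exp_le_exp.2 (by linarith)
      _ ≤ ‖1 + v‖ := by
          rw [norm_def, norm_def]
          refine Real.sqrt_le_sqrt ?_
          simp only [normSq_apply, add_re, one_re, add_im, one_im]
          nlinarith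
  · rw [div_eq_mul_inv, ← Real.exp_neg, neg_sub]
    gcongr
    linarith

end
end

section
/- For every N ≥ 2 there exist analytic maps Φ₁, Φ₂: D^N → D^N with Φ₁(D^N) = Φ₂(D^N) such that the composition map f ↦ f ∘ Φ₁ is not a bounded operator on H²(D^N), while C_{Φ₂} is a compact operator on H²(D^N) with β_N(C_{Φ₂}) = 0 (i.e. lim_{n→∞} [a_n(C_{Φ₂})]^{1/n^{1/N}} = 0). -/
open Complex MeasureTheory Set Filter
open scoped ENNReal Topology

noncomputable section

/-- `convPow c k n` is the coefficient of `z ^ n` in `(∑ c j z ^ j) ^ k`. -/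
def convPow (c : ℕ → ℝ) : ℕ → ℕ → ℝ
  | 0, n => if n = 0 then 1 else 0
  | k + 1, n => ∑ p ∈ Finset.HasAntidiagonal.antidiagonal n, c p.1 * convPow c k p.2

lemma convPow_nonneg {c : ℕ → ℝ} (hc : ∀ j, 0 ≤ c j) (k n : ℕ) : 0 ≤ convPow c k n := by
  induction k generalizing n with
  | zero => unfold convPow; split_ifs <;> norm_num
  | succ k ih => exact Finset.sum_nonneg fun p _ => mul_nonneg (hc _) (ih _)

lemma summable_norm_convPow_mul_pow {c : ℕ → ℝ} (hs : Summable c) (hc : ∀ j, 0 ≤ c j)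
    {z : ℂ} (hz : ‖z‖ ≤ 1) (k : ℕ) :
    (Summable fun n => ‖(convPow c k n : ℂ) * z ^ n‖) ∧
      ∑' n, (convPow c k n : ℂ) * z ^ n = (∑' n, (c n : ℂ) * z ^ n) ^ k := by
  have h1 : Summable fun n => ‖(c n : ℂ) * z ^ n‖ := by
    refine hs.of_nonneg_of_le (fun _ => norm_nonneg _) fun n => ?_
    rw [norm_mul, norm_pow, Complex.norm_real, Real.norm_of_nonneg (hc n)]
    exact mul_le_of_le_one_right (hc n) (pow_le_one₀ (norm_nonneg _) hz)
  induction k with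
  | zero =>
    have h0 : ∀ n, n ≠ 0 → (convPow c 0 n : ℂ) * z ^ n = 0 := fun n hn => by simp [convPow, hn]
    constructor
    · exact summable_of_ne_finset_zero (s := {0}) fun n hn => by
        rw [h0 n (by simpa using hn), norm_zero]
    · rw [tsum_eq_single 0 h0]; simp [convPow]
  | succ k ih =>
    have key : ∀ n, (convPow c (k + 1) n : ℂ) * z ^ n = ∑ p ∈ Finset.HasAntidiagonal.antidiagonal n,
        ((c p.1 : ℂ) * z ^ p.1) * ((convPow c k p.2 : ℂ) * z ^ p.2) := fun n => by
      rw [convPow, Complex.ofReal_sum, Finset.sum_mul]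
      refine Finset.sum_congr rfl fun p hp => ?_
      rw [← Finset.HasAntidiagonal.mem_antidiagonal.1 hp]
      push_cast
      ring
    simp_rw [key]
    refine ⟨summable_norm_sum_mul_antidiagonal_of_summable_norm
      (f := fun n => (c n : ℂ) * z ^ n) (g := fun n => (convPow c k n : ℂ) * z ^ n) h1 ih.1, ?_⟩
    exact (tsum_mul_tsum_eq_tsum_sum_antidiagonal_of_summable_norm
      (f := fun n => (c n : ℂ) * z ^ n) (g := fun n => (convPow c k n : ℂ) * z ^ n)
      h1 ih.1).symm.trans (by rw [ih.2, pow_succ'])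

lemma hasSum_convPow {c : ℕ → ℝ} (hs : HasSum c 1) (hc : ∀ j, 0 ≤ c j) (k : ℕ) :
    HasSum (convPow c k) 1 := by
  obtain ⟨h1, h2⟩ := summable_norm_convPow_mul_pow hs.summable hc (z := 1) (by simp) k
  have h3 : Summable (convPow c k) := by
    simpa [abs_of_nonneg (convPow_nonneg hc k _)] using h1
  have h4 : ∑' n, convPow c k n = 1 := by
    have h5 : ((∑' n, convPow c k n : ℝ) : ℂ) = ((∑' n, c n : ℝ) : ℂ) ^ k := by
      simpa [Complex.ofReal_tsum] using h2
    rw [hs.tsum_eq] at h5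
    exact_mod_cast (by simpa using h5 : ((∑' n, convPow c k n : ℝ) : ℂ) = 1)
  exact h4 ▸ h3.hasSum

/-- Splitting the sequence `c` at `X` gives a uniform bound on the coefficients of its powers. -/
lemma convPow_le {c : ℕ → ℝ} (hs : HasSum c 1) (hc : ∀ j, 0 ≤ c j) {X : ℕ} {s q : ℝ}
    (hX : ∑ j ∈ Finset.range X, c j ≤ 1 - q) (hq : 0 ≤ q) (hsX : ∀ j, X ≤ j → c j ≤ s)
    (k n : ℕ) : convPow c k n ≤ (1 - q) ^ k + k * s := by
  have hs0 : 0 ≤ s := (hc X).trans (hsX X le_rfl)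
  have hq0 : 0 ≤ 1 - q := (Finset.sum_nonneg fun j _ => hc j).trans hX
  induction k generalizing n with
  | zero => unfold convPow; split_ifs <;> simp
  | succ k ih =>
    set M : ℝ := (1 - q) ^ k + k * s
    have hM : 0 ≤ M := by positivity
    have hle : ∀ p : ℕ × ℕ, c p.1 * convPow c k p.2 ≤
        (if p.1 < X then c p.1 else 0) * M + s * convPow c k p.2 := fun p => by
      have h0 := convPow_nonneg hc k p.2
      split_ifs with h
      · nlinarith [mul_le_mul_of_nonneg_left (ih p.2) (hc p.1), mul_nonneg hs0 h0]
      · nlinarith [mul_le_mul_of_nonneg_right (hsX p.1 (not_lt.1 h)) h0]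
    have h1 : ∑ p ∈ Finset.HasAntidiagonal.antidiagonal n, (if p.1 < X then c p.1 else 0) ≤
        1 - q := by
      rw [Finset.Nat.sum_antidiagonal_eq_sum_range_succ_mk, ← Finset.sum_filter]
      refine (Finset.sum_le_sum_of_subset_of_nonneg (fun i hi => ?_) fun i _ _ => hc i).trans hX
      exact Finset.mem_range.2 (Finset.mem_filter.1 hi).2
    have h2 : ∑ p ∈ Finset.HasAntidiagonal.antidiagonal n, convPow c k p.2 ≤ 1 := by
      have h3 := Finset.sum_range_reflect (fun i => convPow c k i) (n + 1)
      simp only [Nat.add_sub_cancel] at h3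
      rw [Finset.Nat.sum_antidiagonal_eq_sum_range_succ_mk]
      refine h3.le.trans ?_
      exact sum_le_hasSum _ (fun i _ => convPow_nonneg hc k i) (hasSum_convPow hs hc k)
    calc convPow c (k + 1) n
        ≤ ∑ p ∈ Finset.HasAntidiagonal.antidiagonal n,
            ((if p.1 < X then c p.1 else 0) * M + s * convPow c k p.2) :=
          Finset.sum_le_sum fun p _ => hle p
      _ ≤ (1 - q) * M + s * 1 := by
          rw [Finset.sum_add_distrib, ← Finset.sum_mul, ← Finset.mul_sum]
          gcongr
      _ ≤ (1 - q) ^ (k + 1) + (k + 1 : ℕ) * s := by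
          have : 0 ≤ q * (k * s) := by positivity
          simp only [M, pow_succ]
          push_cast
          nlinarith

/-- The tails of the coefficient sequence. -/
def slowTail (j : ℕ) : ℝ := 1 / √(1 + Real.log (1 + j))

/-- A probability sequence on `ℕ` with extremely heavy tails. -/
def slowCoeff (j : ℕ) : ℝ := slowTail j - slowTail (j + 1)

lemma one_le_slowTail_aux (j : ℕ) : 1 ≤ 1 + Real.log (1 + j) := by
  have : 0 ≤ Real.log (1 + j) := Real.log_nonneg (by linarith [(j.cast_nonneg : (0 : ℝ) ≤ j)])
  linarith

lemma slowCoeff_nonneg (j : ℕ) : 0 ≤ slowCoeff j := by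
  have h := one_le_slowTail_aux j
  rw [slowCoeff, slowTail, slowTail, sub_nonneg]
  gcongr
  simp

lemma slowCoeff_le (j : ℕ) : slowCoeff j ≤ 1 / (j + 1) := by
  have h1 := one_le_slowTail_aux j
  have h2 := one_le_slowTail_aux (j + 1)
  have h3 : Real.log (1 + (j + 1 : ℕ)) - Real.log (1 + j) ≤ 1 / (j + 1) := by
    rw [← Real.log_div (by positivity) (by positivity)]
    refine (Real.log_le_sub_one_of_pos (by positivity)).trans (le_of_eq ?_)
    push_cast
    field_simp
    ring
  have h4 : Real.log (1 + j) ≤ Real.log (1 + (j + 1 : ℕ)) := by gcongr; simp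
  rw [slowCoeff, slowTail, slowTail]
  generalize Real.log (1 + (j : ℝ)) = a at *
  generalize Real.log (1 + ((j + 1 : ℕ) : ℝ)) = b at *
  have ha : 1 ≤ √(1 + a) := Real.one_le_sqrt.2 h1
  have hb : √(1 + a) ≤ √(1 + b) := Real.sqrt_le_sqrt (by linarith)
  have ha2 := Real.sq_sqrt (by linarith : 0 ≤ 1 + a)
  have hb2 := Real.sq_sqrt (by linarith : 0 ≤ 1 + b)
  refine le_trans ?_ (h3.trans' (le_of_eq (by linarith : (1 + b) - (1 + a) = b - a)))
  generalize √(1 + a) = x at *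
  generalize √(1 + b) = y at *
  rw [← ha2, ← hb2, div_sub_div _ _ (by linarith) (by linarith), div_le_iff₀ (by nlinarith)]
  have h5 : 1 ≤ x * y := by nlinarith
  nlinarith [mul_nonneg (sub_nonneg.2 hb) (by nlinarith : 0 ≤ (y + x) * (x * y) - 1)]

lemma sum_slowCoeff (X : ℕ) : ∑ j ∈ Finset.range X, slowCoeff j = 1 - slowTail X := by
  rw [← (by simp [slowTail] : slowTail 0 = 1), ← Finset.sum_range_sub']
  rfl

lemma hasSum_slowCoeff : HasSum slowCoeff 1 := by
  rw [hasSum_iff_tendsto_nat_of_nonneg slowCoeff_nonneg]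
  simp_rw [sum_slowCoeff]
  have : Tendsto slowTail atTop (𝓝 0) := by
    refine Tendsto.comp tendsto_inv_atTop_zero ?_ |>.congr fun n => (one_div _).symm
    refine Real.tendsto_sqrt_atTop.comp (tendsto_atTop_add_const_left _ _
      (Real.tendsto_log_atTop.comp (tendsto_atTop_add_const_left _ _ tendsto_natCast_atTop_atTop)))
  simpa using this.const_sub 1

lemma eventually_convPow_slowCoeff_le (A : ℝ) (hA : 0 ≤ A) :
    ∀ᶠ k : ℕ in atTop, ∀ n, convPow slowCoeff k n ≤ (k + 1) * Real.exp (-A * √(k + 1)) := by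
  have ht : Tendsto (fun k : ℕ => √((k : ℝ) + 1)) atTop atTop :=
    Real.tendsto_sqrt_atTop.comp (tendsto_atTop_add_const_right _ _ tendsto_natCast_atTop_atTop)
  filter_upwards [ht.eventually_ge_atTop (4 * A ^ 3 + 12 * A ^ 2 + 2)] with k hk n
  have hx2 : √((k : ℝ) + 1) ^ 2 = k + 1 := Real.sq_sqrt (by positivity)
  set x : ℝ := √((k : ℝ) + 1)
  have hx : 2 ≤ x := le_trans (by nlinarith [pow_nonneg hA 3, pow_nonneg hA 2]) hk
  have hX1 : Real.exp (A * x) ≤ ⌈Real.exp (A * x)⌉₊ := Nat.le_ceil _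
  have hX2 : (⌈Real.exp (A * x)⌉₊ : ℝ) < Real.exp (A * x) + 1 :=
    Nat.ceil_lt_add_one (Real.exp_pos _).le
  set X : ℕ := ⌈Real.exp (A * x)⌉₊
  have hlog : Real.log (1 + X) ≤ 2 + A * x := by
    rw [Real.log_le_iff_le_exp (by positivity), Real.exp_add]
    have h1 : 1 ≤ Real.exp (A * x) := Real.one_le_exp (by positivity)
    have h2 : 3 ≤ Real.exp 2 := by linarith [Real.add_one_le_exp (2 : ℝ)]
    nlinarith
  have h1 := one_le_slowTail_aux X
  have hy2 : √(1 + Real.log (1 + X)) ^ 2 = 1 + Real.log (1 + X) := Real.sq_sqrt (by linarith)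
  have hy : 1 ≤ √(1 + Real.log (1 + X)) := Real.one_le_sqrt.2 h1
  have hq : slowTail X = 1 / √(1 + Real.log (1 + X)) := rfl
  set y : ℝ := √(1 + Real.log (1 + X))
  have hq0 : 0 ≤ slowTail X := by rw [hq]; positivity
  have hq1 : slowTail X ≤ 1 := by rw [hq, div_le_one (by linarith)]; exact hy
  have hkq : A * x ≤ k * slowTail X := by
    rw [hq, mul_one_div, le_div_iff₀ (by linarith)]
    have hk2 : (k : ℝ) = x ^ 2 - 1 := by linarith
    rw [hk2]
    refine abs_le_of_sq_le_sq' ?_ (by nlinarith) |>.2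
    have h3 : 4 * A ^ 2 * (3 + A * x) ≤ x ^ 2 := by
      nlinarith [mul_le_mul_of_nonneg_right hk (by linarith : 0 ≤ x),
        mul_nonneg (pow_nonneg hA 2) (by linarith : 0 ≤ x - 1)]
    have h4 : (A * x * y) ^ 2 ≤ x ^ 2 * (A ^ 2 * (3 + A * x)) := by
      rw [mul_pow, hy2, mul_pow, mul_comm (A ^ 2), mul_assoc]
      refine mul_le_mul_of_nonneg_left (mul_le_mul_of_nonneg_left ?_ (by positivity))
        (by positivity)
      linarith
    have h5 : x ^ 2 * (4 * A ^ 2 * (3 + A * x)) ≤ x ^ 2 * x ^ 2 := by gcongr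
    have h6 : x ^ 2 / 2 ≤ x ^ 2 - 1 := by nlinarith
    have h7 : (x ^ 2 / 2) ^ 2 ≤ (x ^ 2 - 1) ^ 2 := by gcongr
    linarith
  refine (convPow_le hasSum_slowCoeff slowCoeff_nonneg (sum_slowCoeff X).le hq0
    (s := Real.exp (-A * x)) (fun j hj => ?_) k n).trans ?_
  · refine (slowCoeff_le j).trans ?_
    rw [neg_mul, Real.exp_neg, ← one_div]
    gcongr
    have : (X : ℝ) ≤ j := by exact_mod_cast hj
    linarith
  · have h6 : (1 - slowTail X) ^ k ≤ Real.exp (-A * x) := by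
      calc (1 - slowTail X) ^ k ≤ Real.exp (-slowTail X) ^ k := by
            refine pow_le_pow_left₀ (by linarith) ?_ k
            linarith [Real.add_one_le_exp (-slowTail X)]
        _ = Real.exp (-(k * slowTail X)) := by rw [← Real.exp_nat_mul, mul_neg]
        _ ≤ Real.exp (-A * x) := by gcongr; linarith
    linarith

lemma eventually_mul_sqrt_convPow_le (A : ℝ) (hA : 0 ≤ A) :
    ∀ᶠ k : ℕ in atTop, ∀ t : ℝ, 0 ≤ t →
      (∀ M, (∀ n, convPow slowCoeff k n ≤ M) → t ^ 2 ≤ M) →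
      (k + 1) * t ≤ Real.exp (-A * √(k + 1)) := by
  have ht : Tendsto (fun k : ℕ => √((k : ℝ) + 1)) atTop atTop :=
    Real.tendsto_sqrt_atTop.comp (tendsto_atTop_add_const_right _ _ tendsto_natCast_atTop_atTop)
  have h3 := ((Real.tendsto_pow_mul_exp_neg_atTop_nhds_zero 3).comp ht).eventually_le_const
    one_pos
  filter_upwards [eventually_convPow_slowCoeff_le (2 * (A + 1)) (by linarith), h3]
    with k hk h3 t ht0 ht
  replace ht := ht _ hk
  simp only [Function.comp_apply] at h3
  have hx2 : √((k : ℝ) + 1) ^ 2 = k + 1 := Real.sq_sqrt (by positivity)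
  have hx0 : 0 ≤ √((k : ℝ) + 1) := Real.sqrt_nonneg _
  rw [← hx2] at ht ⊢
  rw [Real.sqrt_sq hx0] at ht ⊢
  generalize √((k : ℝ) + 1) = x at *
  have h1 : t ≤ x * Real.exp (-(A + 1) * x) := by
    refine abs_le_of_sq_le_sq' (ht.trans (le_of_eq ?_)) (by positivity) |>.2
    rw [mul_pow, ← Real.exp_nat_mul]
    push_cast
    ring_nf
  calc x ^ 2 * t ≤ x ^ 2 * (x * Real.exp (-(A + 1) * x)) := by gcongr
    _ = x ^ 3 * Real.exp (-x) * Real.exp (-A * x) := by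
        rw [(by ring : -(A + 1) * x = -x + -A * x), Real.exp_add]; ring
    _ ≤ 1 * Real.exp (-A * x) := by gcongr
    _ = _ := one_mul _

lemma summable_exp_neg_sqrt : Summable fun k : ℕ => Real.exp (-√((k : ℝ) + 1)) := by
  have h := ((summable_nat_add_iff 1).2 (Real.summable_one_div_nat_pow.2 one_lt_two)).mul_left 24
  refine h.of_nonneg_of_le (fun _ => (Real.exp_pos _).le) fun k => ?_
  have hx2 : √((k : ℝ) + 1) ^ 2 = k + 1 := Real.sq_sqrt (by positivity)
  have h4 := Real.pow_div_factorial_le_exp (√((k : ℝ) + 1)) (Real.sqrt_nonneg _) 4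
  have h5 : √((k : ℝ) + 1) ^ 4 = (k + 1) ^ 2 := by rw [← hx2]; simp only [← pow_mul]; norm_num [hx2]
  rw [h5] at h4
  norm_num [Nat.factorial] at h4
  rw [Real.exp_neg, mul_one_div, inv_le_comm₀ (Real.exp_pos _) (by positivity)]
  push_cast
  rwa [inv_div]

/-- Tails of a series with terms `≤ exp (-A √(k + 1))` for every `A` decay at the same rate. -/
lemma eventually_tsum_tail_le {t : ℕ → ℝ} (ht0 : ∀ k, 0 ≤ t k)
    (ht : ∀ A : ℝ, 0 ≤ A → ∀ᶠ k : ℕ in atTop, t k ≤ Real.exp (-A * √(k + 1)))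
    {A : ℝ} (hA : 0 ≤ A) :
    ∀ᶠ n : ℕ in atTop, ∑' k, t (k + n) ≤ Real.exp (-A * √(n + 1)) := by
  have h1 := (_root_.tendsto_sum_nat_add fun k : ℕ =>
    Real.exp (-√((k : ℝ) + 1))).eventually_le_const one_pos
  filter_upwards [eventually_forall_ge_atTop.2 (ht (A + 1) (by linarith)), h1] with n hn h1
  have hs := (summable_nat_add_iff n).2 summable_exp_neg_sqrt
  have hle : ∀ k, t (k + n) ≤
      Real.exp (-A * √(n + 1)) * Real.exp (-√(((k + n : ℕ) : ℝ) + 1)) := fun k => by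
    refine (hn (k + n) (by omega)).trans ?_
    rw [← Real.exp_add]
    have : √((n : ℝ) + 1) ≤ √(((k + n : ℕ) : ℝ) + 1) := by gcongr; simp
    gcongr
    nlinarith
  have hs2 := hs.mul_left (Real.exp (-A * √(n + 1)))
  calc ∑' k, t (k + n) ≤ ∑' k, Real.exp (-A * √(n + 1)) * Real.exp (-√(((k + n : ℕ) : ℝ) + 1)) :=
        (hs2.of_nonneg_of_le (fun k => ht0 _) hle).tsum_le_tsum hle hs2
    _ ≤ Real.exp (-A * √(n + 1)) * 1 := by
        rw [tsum_mul_left]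
        gcongr
    _ = _ := mul_one _

lemma summable_of_eventually_le_exp {t : ℕ → ℝ} (ht0 : ∀ k, 0 ≤ t k)
    (ht : ∀ A : ℝ, 0 ≤ A → ∀ᶠ k : ℕ in atTop, t k ≤ Real.exp (-A * √(k + 1))) : Summable t := by
  refine summable_exp_neg_sqrt.of_norm_bounded_eventually_nat ?_
  filter_upwards [ht 1 zero_le_one] with k hk
  rw [Real.norm_of_nonneg (ht0 k)]
  simpa using hk

lemma approxNum_nonneg {E F : Type*} [NormedAddCommGroup E] [NormedAddCommGroup F]
    [NormedSpace ℂ E] [NormedSpace ℂ F] (n : ℕ) (T : E →L[ℂ] F) : 0 ≤ approxNum n T := by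
  refine Real.sInf_nonneg ?_
  rintro c ⟨R, -, rfl⟩
  exact norm_nonneg _

lemma approxNum_le {E F : Type*} [NormedAddCommGroup E] [NormedAddCommGroup F]
    [NormedSpace ℂ E] [NormedSpace ℂ F] {n : ℕ} {T R : E →L[ℂ] F}
    (hR : Module.rank ℂ (LinearMap.range (R : E →ₗ[ℂ] F)) < (n : Cardinal)) :
    approxNum n T ≤ ‖T - R‖ := by
  refine csInf_le ⟨0, ?_⟩ ⟨R, hR, rfl⟩
  rintro c ⟨R, -, rfl⟩
  exact norm_nonneg _

/-- A sum of rank one operators whose norms decay faster than `exp (-A √(k + 1))` for all `A`. -/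
lemma compact_and_approxNum_tsum_smulRight {E F : Type*} [NormedAddCommGroup E]
    [NormedAddCommGroup F] [NormedSpace ℂ E] [NormedSpace ℂ F] [CompleteSpace F]
    (b : ℕ → E →L[ℂ] ℂ) (e : ℕ → F) (t : ℕ → ℝ) (hbe : ∀ k, ‖(b k).smulRight (e k)‖ ≤ t k)
    (ht : ∀ A : ℝ, 0 ≤ A → ∀ᶠ k : ℕ in atTop, t k ≤ Real.exp (-A * √(k + 1))) :
    Summable (fun k => (b k).smulRight (e k)) ∧
    IsCompactOperator ⇑(∑' k, (b k).smulRight (e k)) ∧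
    ∀ A : ℝ, 0 ≤ A → ∀ᶠ n : ℕ in atTop,
      approxNum (n + 1) (∑' k, (b k).smulRight (e k)) ≤ Real.exp (-A * √(n + 1)) := by
  have ht0 : ∀ k, 0 ≤ t k := fun k => (norm_nonneg _).trans (hbe k)
  have hst : Summable t := summable_of_eventually_le_exp ht0 ht
  have hs : Summable (fun k => (b k).smulRight (e k)) := hst.of_norm_bounded hbe
  refine ⟨hs, ?_, fun A hA => ?_⟩
  · refine isCompactOperator_of_tendsto hs.hasSum.tendsto_sum_nat (Eventually.of_forall fun n => ?_)
    induction n with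
    | zero => simpa using! isCompactOperator_zero
    | succ n ih =>
      rw [Finset.sum_range_succ]
      exact ih.add ((isCompactOperator_of_locallyCompactSpace_rng
        (ContinuousLinearMap.toSpanSingleton ℂ (e n))).comp_clm (b n))
  · filter_upwards [eventually_tsum_tail_le ht0 ht hA] with n hn
    refine (approxNum_le (R := ∑ k ∈ Finset.range n, (b k).smulRight (e k)) ?_).trans ?_
    · classical
      have hsub : LinearMap.range
          ((∑ k ∈ Finset.range n, (b k).smulRight (e k) : E →L[ℂ] F) : E →ₗ[ℂ] F) ≤
          Submodule.span ℂ (((Finset.range n).image e : Finset F) : Set F) := by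
        rintro _ ⟨x, rfl⟩
        simp only [ContinuousLinearMap.coe_coe, sum_apply,
          ContinuousLinearMap.smulRight_apply]
        exact Submodule.sum_mem _ fun k hk => Submodule.smul_mem _ _
          (Submodule.subset_span (Finset.mem_coe.2 (Finset.mem_image_of_mem e hk)))
      refine ((Submodule.rank_mono hsub).trans (rank_span_finset_le _)).trans_lt ?_
      have := Finset.card_image_le (s := Finset.range n) (f := e)
      rw [Finset.card_range] at this
      exact_mod_cast Nat.lt_succ_of_le this
    · rw [← hs.sum_add_tsum_nat_add n, add_sub_cancel_left]
      exact (tsum_of_norm_bounded ((summable_nat_add_iff n).2 hst).hasSum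
        fun k => hbe (k + n)).trans hn

lemma tendsto_rpow_of_eventually_le_exp {N : ℕ} (hN : 2 ≤ N) {a : ℕ → ℝ} (ha0 : ∀ n, 0 ≤ a n)
    (ha : ∀ A : ℝ, 0 ≤ A → ∀ᶠ n : ℕ in atTop, a n ≤ Real.exp (-A * √(n + 1))) :
    Tendsto (fun n : ℕ => a n ^ (1 / ((n : ℝ) + 1) ^ (1 / (N : ℝ)))) atTop (𝓝 0) := by
  rw [Metric.tendsto_nhds]
  intro ε hε
  obtain ⟨A, hA, hAε⟩ : ∃ A : ℝ, 0 ≤ A ∧ Real.exp (-A) < ε :=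
    ((eventually_ge_atTop 0).and
      (Real.tendsto_exp_neg_atTop_nhds_zero.eventually_lt_const hε)).exists
  filter_upwards [ha A hA] with n hn
  have hy : 0 < ((n : ℝ) + 1) ^ (1 / (N : ℝ)) := by positivity
  have hle : ((n : ℝ) + 1) ^ (1 / (N : ℝ)) ≤ √(n + 1) := by
    rw [Real.sqrt_eq_rpow]
    have : (2 : ℝ) ≤ N := by exact_mod_cast hN
    gcongr
    linarith [(n.cast_nonneg : (0 : ℝ) ≤ n)]
  rw [Real.dist_0_eq_abs, abs_of_nonneg (Real.rpow_nonneg (ha0 n) _)]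
  refine lt_of_le_of_lt ?_ hAε
  calc a n ^ (1 / ((n : ℝ) + 1) ^ (1 / (N : ℝ)))
      ≤ Real.exp (-A * √(n + 1)) ^ (1 / ((n : ℝ) + 1) ^ (1 / (N : ℝ))) :=
        Real.rpow_le_rpow (ha0 n) hn (by positivity)
    _ = Real.exp (-(A * √(n + 1) / ((n : ℝ) + 1) ^ (1 / (N : ℝ)))) := by
        rw [← Real.exp_mul]; congr 1; ring
    _ ≤ Real.exp (-A) := by
        gcongr
        rw [le_div_iff₀ hy]
        gcongr

lemma exists_H2poly_extend {N : ℕ} {β : Type*} {g : β → Fin N → ℕ} (hg : Function.Injective g)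
    {f : β → ℂ} (hf : Summable fun b => ‖f b‖ ^ 2) :
    ∃ x : H2poly N, (∀ α, x α = Function.extend g f 0 α) ∧ ‖x‖ ^ 2 = ∑' b, ‖f b‖ ^ 2 := by
  have hext : (fun α => ‖Function.extend g f 0 α‖ ^ 2) =
      Function.extend g (fun b => ‖f b‖ ^ 2) 0 := by
    funext α
    by_cases h : ∃ b, g b = α
    · obtain ⟨b, rfl⟩ := h
      rw [hg.extend_apply, hg.extend_apply]
    · rw [Function.extend_apply' _ _ _ h, Function.extend_apply' _ _ _ h]
      simp
  have hs : Summable fun α => ‖Function.extend g f 0 α‖ ^ 2 := by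
    rw [hext]; exact (summable_extend_zero hg).2 hf
  have hmem : Memℓp (E := fun _ : Fin N → ℕ => ℂ) (Function.extend g f 0) 2 := by
    rw [memℓp_gen_iff (by simp)]
    simpa using hs
  refine ⟨⟨_, hmem⟩, fun _ => rfl, ?_⟩
  have h := lp.norm_rpow_eq_tsum (p := 2) (by simp) (⟨_, hmem⟩ : H2poly N)
  simp only [ENNReal.toReal_ofNat, Real.rpow_ofNat] at h
  rw [h]
  change ∑' α, ‖Function.extend g f 0 α‖ ^ 2 = _
  rw [hext, tsum_extend_zero hg]

/-- The multi-index `(m, n, 0, …, 0)`. -/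
def pairIndex (M : ℕ) (p : ℕ × ℕ) : Fin (M + 2) → ℕ := Fin.cons p.1 (Fin.cons p.2 0)

lemma pairIndex_injective (M : ℕ) : Function.Injective (pairIndex M) := fun _ _ h =>
  Prod.ext (congrFun h 0) (congrFun h 1)

lemma prod_pow_pairIndex {M : ℕ} (z : Fin (M + 2) → ℂ) (p : ℕ × ℕ) :
    ∏ i, z i ^ pairIndex M p i = z 0 ^ p.1 * z 1 ^ p.2 := by
  rw [Fin.prod_univ_succ, Fin.prod_univ_succ]
  simp [pairIndex]

lemma mem_range_pairIndex {M : ℕ} {α : Fin (M + 2) → ℕ} (h : ∀ i : Fin M, α i.succ.succ = 0) :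
    α ∈ Set.range (pairIndex M) := by
  refine ⟨(α 0, α 1), ?_⟩
  funext i
  refine Fin.cases rfl (fun i => Fin.cases rfl (fun i => ?_) i) i
  simp [pairIndex, h]

lemma eval_eq_tsum_pair {M : ℕ} {a : H2poly (M + 2)} {z : Fin (M + 2) → ℂ}
    (h : ∀ α ∉ Set.range (pairIndex M), a α * ∏ i, z i ^ α i = 0) :
    H2poly.eval a z = ∑' p : ℕ × ℕ, a (pairIndex M p) * (z 0 ^ p.1 * z 1 ^ p.2) := by
  rw [H2poly.eval, ← (pairIndex_injective M).tsum_eq]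
  · simp_rw [prod_pow_pairIndex]
  · intro α hα
    by_contra hr
    exact hα (h α hr)

/-- The point `(w, w, 0, …, 0)`. -/
def diagPoint (M : ℕ) (w : ℂ) : Fin (M + 2) → ℂ := Fin.cons w (Fin.cons w 0)

lemma prod_pow_eq_zero {M : ℕ} {z : Fin (M + 2) → ℂ} (hz : ∀ i : Fin M, z i.succ.succ = 0)
    {α : Fin (M + 2) → ℕ} (hα : α ∉ Set.range (pairIndex M)) : ∏ i, z i ^ α i = 0 := by
  by_contra hne
  refine hα (mem_range_pairIndex fun i => ?_)
  by_contra h0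
  exact hne (Finset.prod_eq_zero (Finset.mem_univ i.succ.succ) (by rw [hz, zero_pow h0]))

lemma diagPoint_mem {M : ℕ} {w : ℂ} (hw : ‖w‖ < 1) : diagPoint M w ∈ polyDisk (M + 2) := by
  intro i
  refine Fin.cases hw (fun i => Fin.cases hw (fun i => ?_) i) i
  simp [diagPoint]

lemma differentiable_diagPoint (M : ℕ) : Differentiable ℂ (diagPoint M) := by
  rw [differentiable_pi]
  intro i
  refine Fin.cases differentiable_id (fun i => Fin.cases differentiable_id (fun i => ?_) i) i
  simp [diagPoint]

/-- The functional giving the coefficient of `w ^ k` in `f (w, w, 0, …, 0)`. -/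
def diagCoeff (M k : ℕ) : H2poly (M + 2) →L[ℂ] ℂ :=
  ∑ p ∈ Finset.HasAntidiagonal.antidiagonal k, lp.evalCLM ℂ (fun _ => ℂ) 2 (pairIndex M p)

lemma diagCoeff_apply {M : ℕ} (k : ℕ) (a : H2poly (M + 2)) :
    diagCoeff M k a = ∑ p ∈ Finset.HasAntidiagonal.antidiagonal k, a (pairIndex M p) := by
  simp only [diagCoeff, sum_apply]
  rfl

lemma norm_diagCoeff_apply_le {M : ℕ} (k : ℕ) (a : H2poly (M + 2)) :
    ‖diagCoeff M k a‖ ≤ (k + 1) * ‖a‖ := by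
  rw [diagCoeff_apply]
  refine (norm_sum_le_of_le _ fun p _ => lp.norm_apply_le_norm two_ne_zero a _).trans ?_
  simp

lemma eval_diagPoint {M : ℕ} (a : H2poly (M + 2)) {w : ℂ} (hw : ‖w‖ < 1) :
    H2poly.eval a (diagPoint M w) = ∑' k, diagCoeff M k a * w ^ k := by
  rw [eval_eq_tsum_pair fun α hα => by
    rw [prod_pow_eq_zero (fun i => by simp [diagPoint]) hα, mul_zero]]
  have h0 : diagPoint M w 0 = w := rfl
  have h1 : diagPoint M w 1 = w := rfl
  rw [h0, h1]
  have hg : Summable fun n : ℕ => ‖w‖ ^ n := summable_geometric_of_lt_one (norm_nonneg _) hw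
  have hs : Summable fun p : ℕ × ℕ => a (pairIndex M p) * (w ^ p.1 * w ^ p.2) := by
    refine ((hg.mul_of_nonneg hg (fun _ => by positivity) fun _ => by positivity).mul_left
      ‖a‖).of_norm_bounded fun p => ?_
    rw [norm_mul, norm_mul, norm_pow, norm_pow]
    gcongr
    exact lp.norm_apply_le_norm two_ne_zero a _
  rw [← Finset.HasAntidiagonal.sigmaAntidiagonalEquivProd.tsum_eq]
  refine ((Finset.HasAntidiagonal.sigmaAntidiagonalEquivProd.summable_iff.2 hs).tsum_sigma'
    fun k => (hasSum_fintype (β := Finset.HasAntidiagonal.antidiagonal k) _).summable).trans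
    (tsum_congr fun k => ?_)
  rw [diagCoeff_apply, Finset.sum_mul, tsum_fintype,
    ← Finset.sum_coe_sort _ fun i => a (pairIndex M i) * w ^ k]
  refine Finset.sum_congr rfl fun p _ => ?_
  have hp := Finset.HasAntidiagonal.mem_antidiagonal.1 p.2
  simp only [Function.comp_apply, Finset.HasAntidiagonal.sigmaAntidiagonalEquivProd_apply]
  rw [← pow_add, hp]

/-- `slowFun` maps the disk to itself, and its powers have very small `H²` norms although its
supremum is `1`. -/
def slowFun (z : ℂ) : ℂ := ∑' n, (slowCoeff n : ℂ) * z ^ n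

lemma norm_slowCoeff_mul_le {z : ℂ} (hz : ‖z‖ ≤ 1) (n : ℕ) :
    ‖(slowCoeff n : ℂ) * z ^ n‖ ≤ slowCoeff n := by
  rw [norm_mul, norm_pow, Complex.norm_real, Real.norm_of_nonneg (slowCoeff_nonneg n)]
  exact mul_le_of_le_one_right (slowCoeff_nonneg n) (pow_le_one₀ (norm_nonneg _) hz)

lemma norm_slowFun_le {z : ℂ} (hz : ‖z‖ ≤ 1) : ‖slowFun z‖ ≤ 1 :=
  tsum_of_norm_bounded hasSum_slowCoeff (norm_slowCoeff_mul_le hz)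

lemma differentiableOn_slowFun : DifferentiableOn ℂ slowFun (Metric.ball 0 1) :=
  differentiableOn_tsum_of_summable_norm hasSum_slowCoeff.summable
    (fun n => ((differentiable_id.pow n).const_mul _).differentiableOn) Metric.isOpen_ball
    fun n _ hz => norm_slowCoeff_mul_le (mem_ball_zero_iff.1 hz).le n

lemma exists_lt_norm_slowFun {s : ℝ} (hs : s < 1) : ∃ z : ℂ, ‖z‖ < 1 ∧ s < ‖slowFun z‖ := by
  have hcont : ContinuousOn slowFun (Metric.closedBall 0 1) :=
    continuousOn_tsum (fun n => by fun_prop) hasSum_slowCoeff.summable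
      fun n z hz => norm_slowCoeff_mul_le (by simpa using hz) n
  have h1 : slowFun 1 = 1 := by
    simp only [slowFun, one_pow, mul_one, ← Complex.ofReal_tsum, hasSum_slowCoeff.tsum_eq,
      Complex.ofReal_one]
  have hmem : (1 : ℂ) ∈ closure (Metric.ball (0 : ℂ) 1) := by
    rw [closure_ball _ one_ne_zero]; simp
  have : (𝓝[Metric.ball (0 : ℂ) 1] 1).NeBot := mem_closure_iff_nhdsWithin_neBot.1 hmem
  have ht : Tendsto (fun z => ‖slowFun z‖) (𝓝[Metric.ball (0 : ℂ) 1] 1) (𝓝 1) := by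
    have := ((hcont 1 (by simp)).mono Metric.ball_subset_closedBall).norm
    simpa [ContinuousWithinAt, h1] using this
  obtain ⟨z, hz, hz1⟩ := ((ht.eventually_const_lt hs).and self_mem_nhdsWithin).exists
  exact ⟨z, by simpa using hz1, hz⟩

/-- The coefficients of `z 0 ^ k * slowFun (z 1) ^ k`. -/
lemma exists_H2poly_slowFun_pow (M k : ℕ) : ∃ e : H2poly (M + 2),
    (∀ m n, e (pairIndex M (m, n)) = if m = k then (convPow slowCoeff k n : ℂ) else 0) ∧
    (∀ α ∉ Set.range (pairIndex M), e α = 0) ∧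
    ∀ B, (∀ n, convPow slowCoeff k n ≤ B) → ‖e‖ ^ 2 ≤ B := by
  have hnn := convPow_nonneg slowCoeff_nonneg k
  have hsum := hasSum_convPow hasSum_slowCoeff slowCoeff_nonneg k
  have hle1 : ∀ n, convPow slowCoeff k n ≤ 1 := fun n => le_hasSum hsum n fun j _ => hnn j
  have hs : Summable fun n => ‖(convPow slowCoeff k n : ℂ)‖ ^ 2 := by
    refine hsum.summable.of_nonneg_of_le (fun _ => by positivity) fun n => ?_
    rw [Complex.norm_real, Real.norm_of_nonneg (hnn n)]
    nlinarith [hnn n, hle1 n]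
  have hinj : Function.Injective fun n => pairIndex M (k, n) := fun m n h =>
    congrArg Prod.snd (pairIndex_injective M h)
  obtain ⟨e, he, hnorm⟩ := exists_H2poly_extend hinj hs
  refine ⟨e, fun m n => ?_, fun α hα => ?_, fun B hB => ?_⟩
  · rw [he]
    split_ifs with h
    · subst h
      exact hinj.extend_apply _ _ n
    · refine Function.extend_apply' _ _ _ ?_
      rintro ⟨j, hj⟩
      exact h (congrArg Prod.fst (pairIndex_injective M hj)).symm
  · rw [he]
    refine Function.extend_apply' _ _ _ ?_
    rintro ⟨j, rfl⟩
    exact hα ⟨_, rfl⟩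
  · rw [hnorm]
    have h2 : ∀ n, ‖(convPow slowCoeff k n : ℂ)‖ ^ 2 ≤ B * convPow slowCoeff k n := fun n => by
      rw [Complex.norm_real, Real.norm_of_nonneg (hnn n), sq]
      exact mul_le_mul_of_nonneg_right (hB n) (hnn n)
    simpa using hasSum_le h2 hs.hasSum (hsum.mul_left B)

/-- The symbol of the compact composition operator. -/
def slowSymbol (M : ℕ) (z : Fin (M + 2) → ℂ) : Fin (M + 2) → ℂ :=
  diagPoint M (z 0 * slowFun (z 1))

lemma norm_mul_slowFun_lt {M : ℕ} {z : Fin (M + 2) → ℂ} (hz : z ∈ polyDisk (M + 2)) :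
    ‖z 0 * slowFun (z 1)‖ < 1 := by
  rw [norm_mul]
  have h1 := norm_slowFun_le (hz 1).le
  nlinarith [hz 0, norm_nonneg (z 0)]

lemma tsum_pair_slowFun {z w : ℂ} (hz : ‖z‖ < 1) (hw : ‖w‖ ≤ 1) {b : ℕ → ℂ} {C : ℝ}
    (hb : ∀ k : ℕ, ‖b k‖ ≤ (k + 1) * C) :
    ∑' p : ℕ × ℕ, b p.1 * (convPow slowCoeff p.1 p.2 : ℂ) * (z ^ p.1 * w ^ p.2) =
      ∑' k, b k * (z * slowFun w) ^ k := by
  have hnn := fun k => convPow_nonneg slowCoeff_nonneg k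
  have hsum := hasSum_convPow hasSum_slowCoeff slowCoeff_nonneg
  have hC : 0 ≤ C := by simpa using (norm_nonneg _).trans (hb 0)
  have hgeo : Summable fun m : ℕ => ((m : ℝ) + 1) * C * ‖z‖ ^ m := by
    have h1 := summable_pow_mul_geometric_of_norm_lt_one (R := ℝ) 1 (r := ‖z‖) (by simpa using hz)
    have h0 := summable_geometric_of_lt_one (norm_nonneg z) hz
    refine ((h1.add h0).mul_left C).congr fun m => ?_
    ring
  have hs : Summable fun p : ℕ × ℕ =>
      ((p.1 : ℝ) + 1) * C * ‖z‖ ^ p.1 * convPow slowCoeff p.1 p.2 := by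
    have h0 : (0 : ℕ × ℕ → ℝ) ≤ fun p =>
        ((p.1 : ℝ) + 1) * C * ‖z‖ ^ p.1 * convPow slowCoeff p.1 p.2 := fun p =>
      mul_nonneg (by positivity) (hnn p.1 p.2)
    refine (summable_prod_of_nonneg h0).2 ⟨fun m => ?_, ?_⟩
    · exact (hsum m).summable.mul_left (((m : ℝ) + 1) * C * ‖z‖ ^ m)
    · simpa only [tsum_mul_left, (hsum _).tsum_eq, mul_one] using hgeo
  have hs2 : Summable fun p : ℕ × ℕ =>
      b p.1 * (convPow slowCoeff p.1 p.2 : ℂ) * (z ^ p.1 * w ^ p.2) := by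
    refine hs.of_norm_bounded fun p => ?_
    simp only [norm_mul, norm_pow, Complex.norm_real, Real.norm_of_nonneg (hnn p.1 p.2)]
    have h1 : ‖w‖ ^ p.2 ≤ 1 := pow_le_one₀ (norm_nonneg _) hw
    have h0 := hnn p.1 p.2
    calc ‖b p.1‖ * convPow slowCoeff p.1 p.2 * (‖z‖ ^ p.1 * ‖w‖ ^ p.2)
        ≤ ((p.1 + 1) * C) * convPow slowCoeff p.1 p.2 * (‖z‖ ^ p.1 * 1) := by
          gcongr; exact hb _
      _ = _ := by ring
  rw [hs2.tsum_prod]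
  refine tsum_congr fun k => ?_
  rw [mul_pow, slowFun, ← (summable_norm_convPow_mul_pow hasSum_slowCoeff.summable
    slowCoeff_nonneg hw k).2, ← tsum_mul_left, ← tsum_mul_left]
  refine tsum_congr fun n => ?_
  ring

lemma hasSum_smulRight_apply {M : ℕ} {b : ℕ → H2poly (M + 2) →L[ℂ] ℂ} {e : ℕ → H2poly (M + 2)}
    {T : H2poly (M + 2) →L[ℂ] H2poly (M + 2)}
    (hs : HasSum (fun k => (b k).smulRight (e k)) T) (a : H2poly (M + 2)) (α : Fin (M + 2) → ℕ) :
    HasSum (fun k => b k a * e k α) (T a α) :=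
  (hs.mapL (ContinuousLinearMap.apply ℂ _ a)).mapL (lp.evalCLM ℂ (fun _ => ℂ) 2 α)

lemma isCompOpPoly_slowSymbol {M : ℕ} {e : ℕ → H2poly (M + 2)}
    {T : H2poly (M + 2) →L[ℂ] H2poly (M + 2)}
    (he : ∀ k m n, e k (pairIndex M (m, n)) = if m = k then (convPow slowCoeff k n : ℂ) else 0)
    (hrange : ∀ k, ∀ α ∉ Set.range (pairIndex M), e k α = 0)
    (hs : HasSum (fun k => (diagCoeff M k).smulRight (e k)) T) :
    IsCompOpPoly (slowSymbol M) T := by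
  intro a z hz
  have hT : ∀ α, HasSum (fun k => diagCoeff M k a * e k α) (T a α) := hasSum_smulRight_apply hs a
  have hT1 : ∀ p : ℕ × ℕ, T a (pairIndex M p) =
      diagCoeff M p.1 a * (convPow slowCoeff p.1 p.2 : ℂ) := by
    rintro ⟨m, n⟩
    have h := hasSum_single (f := fun k => diagCoeff M k a * e k (pairIndex M (m, n))) m
      fun k hk => by rw [he, if_neg hk.symm, mul_zero]
    rw [he, if_pos rfl] at h
    exact (hT _).unique h
  have hT0 : ∀ α ∉ Set.range (pairIndex M), T a α = 0 := fun α hα => by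
    rw [← (hT _).tsum_eq]
    simp [hrange _ α hα]
  rw [slowSymbol, eval_diagPoint a (norm_mul_slowFun_lt hz),
    eval_eq_tsum_pair fun α hα => by rw [hT0 α hα, zero_mul], tsum_congr fun p => by rw [hT1 p]]
  have hz1 : ‖z 1‖ ≤ 1 := (hz 1).le
  have h := tsum_pair_slowFun (b := fun k => diagCoeff M k a) (C := ‖a‖) (hz 0) hz1
    fun k => norm_diagCoeff_apply_le k a
  exact h

lemma exists_compOp_slowSymbol (M : ℕ) : ∃ T : H2poly (M + 2) →L[ℂ] H2poly (M + 2),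
    IsCompOpPoly (slowSymbol M) T ∧ IsCompactOperator ⇑T ∧
    Tendsto (fun n : ℕ => approxNum (n + 1) T ^
      (1 / ((n : ℝ) + 1) ^ (1 / ((M + 2 : ℕ) : ℝ)))) atTop (𝓝 0) := by
  choose e he hrange hnorm using exists_H2poly_slowFun_pow M
  have hb : ∀ k : ℕ, ‖(diagCoeff M k).smulRight (e k)‖ ≤ (k + 1) * ‖e k‖ := fun k => by
    rw [ContinuousLinearMap.norm_smulRight_apply]
    gcongr
    exact ContinuousLinearMap.opNorm_le_bound _ (by positivity) (norm_diagCoeff_apply_le k)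
  have hsmall : ∀ A : ℝ, 0 ≤ A → ∀ᶠ k : ℕ in atTop,
      ((k : ℝ) + 1) * ‖e k‖ ≤ Real.exp (-A * √((k : ℝ) + 1)) := fun A hA =>
    (eventually_mul_sqrt_convPow_le A hA).mono fun k hk => hk _ (norm_nonneg _) (hnorm k)
  obtain ⟨hs, hcomp, happ⟩ := compact_and_approxNum_tsum_smulRight (diagCoeff M) e _ hb hsmall
  exact ⟨_, isCompOpPoly_slowSymbol he hrange hs.hasSum, hcomp,
    tendsto_rpow_of_eventually_le_exp (by omega) (fun n => approxNum_nonneg _ _) happ⟩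

lemma image_slowSymbol (M : ℕ) : (fun z : Fin (M + 2) → ℂ => diagPoint M (z 0)) ''
    polyDisk (M + 2) = slowSymbol M '' polyDisk (M + 2) := by
  apply Set.Subset.antisymm
  · rintro _ ⟨z, hz, rfl⟩
    obtain ⟨v, hv, hlt⟩ := exists_lt_norm_slowFun (hz 0)
    have hne : slowFun v ≠ 0 := norm_pos_iff.1 ((norm_nonneg _).trans_lt hlt)
    refine ⟨Fin.cons (z 0 / slowFun v) (Fin.cons v 0), fun i => ?_, ?_⟩
    · refine Fin.cases ?_ (fun i => Fin.cases hv (fun i => ?_) i) i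
      · simpa [div_lt_one (norm_pos_iff.2 hne)] using hlt
      · simp
    · change diagPoint M (z 0 / slowFun v * slowFun v) = diagPoint M (z 0)
      rw [div_mul_cancel₀ _ hne]
  · rintro _ ⟨z, hz, rfl⟩
    exact ⟨diagPoint M (z 0 * slowFun (z 1)), diagPoint_mem (norm_mul_slowFun_lt hz), rfl⟩

/-- The reproducing kernel of `H²` of the polydisk at `(x, y, 0, …, 0)`. -/
lemma exists_kernel (M : ℕ) {x y : ℝ} (hx0 : 0 ≤ x) (hx : x < 1) (hy0 : 0 ≤ y) (hy : y < 1) :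
    ∃ K : H2poly (M + 2), ‖K‖ ^ 2 = 1 / ((1 - x ^ 2) * (1 - y ^ 2)) ∧
      ∀ a : H2poly (M + 2),
        H2poly.eval a (Fin.cons (x : ℂ) (Fin.cons (y : ℂ) 0)) = inner ℂ K a := by
  have hx2 : x ^ 2 < 1 := by nlinarith
  have hy2 : y ^ 2 < 1 := by nlinarith
  have hxs := hasSum_geometric_of_lt_one (sq_nonneg x) hx2
  have hys := hasSum_geometric_of_lt_one (sq_nonneg y) hy2
  have hs := hxs.mul hys (hxs.summable.mul_of_nonneg hys.summable
    (fun _ => by positivity) fun _ => by positivity)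
  have heq : (fun p : ℕ × ℕ => ‖(x : ℂ) ^ p.1 * (y : ℂ) ^ p.2‖ ^ 2) =
      fun p : ℕ × ℕ => (x ^ 2) ^ p.1 * (y ^ 2) ^ p.2 := by
    funext p
    simp only [norm_mul, norm_pow, Complex.norm_real, Real.norm_of_nonneg hx0,
      Real.norm_of_nonneg hy0]
    ring
  obtain ⟨K, hK, hKn⟩ := exists_H2poly_extend (pairIndex_injective M)
    (f := fun p => (x : ℂ) ^ p.1 * (y : ℂ) ^ p.2) (heq ▸ hs.summable)
  refine ⟨K, ?_, fun a => ?_⟩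
  · rw [hKn, heq, hs.tsum_eq, one_div, mul_inv]
  · rw [lp.inner_eq_tsum, H2poly.eval]
    refine tsum_congr fun α => ?_
    rw [hK, RCLike.inner_apply]
    by_cases h : α ∈ Set.range (pairIndex M)
    · obtain ⟨p, rfl⟩ := h
      rw [(pairIndex_injective M).extend_apply, prod_pow_pairIndex]
      simp
    · rw [prod_pow_eq_zero (fun i => by simp) h, Function.extend_apply' _ _ _ h]
      simp

lemma not_exists_compOp_diag (M : ℕ) : ¬ ∃ T : H2poly (M + 2) →L[ℂ] H2poly (M + 2),
    IsCompOpPoly (fun z => diagPoint M (z 0)) T := by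
  rintro ⟨T, hT⟩
  have key : ∀ x : ℝ, 0 ≤ x → x < 1 → 1 ≤ ‖T‖ ^ 2 * (1 - x ^ 2) := fun x hx0 hx => by
    obtain ⟨K, hKn, hK⟩ := exists_kernel M hx0 hx le_rfl one_pos
    obtain ⟨L, hLn, hL⟩ := exists_kernel M hx0 hx hx0 hx
    have hd : 0 < 1 - x ^ 2 := by nlinarith
    have hz : (Fin.cons (x : ℂ) (Fin.cons ((0 : ℝ) : ℂ) 0) : Fin (M + 2) → ℂ) ∈
        polyDisk (M + 2) := fun i => by
      refine Fin.cases ?_ (fun i => Fin.cases ?_ (fun i => ?_) i) i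
      · simpa [abs_of_nonneg hx0] using hx
      · simp
      · simp
    have h := hT L _ hz
    rw [hK] at h
    change _ = H2poly.eval L (Fin.cons (x : ℂ) (Fin.cons (x : ℂ) 0)) at h
    rw [hL, inner_self_eq_norm_sq_to_K] at h
    have h1 : ‖L‖ ^ 2 ≤ ‖K‖ * (‖T‖ * ‖L‖) := by
      calc ‖L‖ ^ 2 = ‖inner ℂ K (T L)‖ := by rw [h]; simp
        _ ≤ ‖K‖ * ‖T L‖ := norm_inner_le_norm _ _
        _ ≤ _ := by gcongr; exact T.le_opNorm L
    have h2 : (‖L‖ ^ 2) ^ 2 ≤ ‖K‖ ^ 2 * (‖T‖ ^ 2 * ‖L‖ ^ 2) :=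
      (pow_le_pow_left₀ (by positivity) h1 2).trans (by rw [mul_pow, mul_pow])
    rw [hLn, hKn] at h2
    have h3 : (1 / ((1 - x ^ 2) * (1 - x ^ 2))) ^ 2 * ((1 - x ^ 2) ^ 4) ≤
        1 / ((1 - x ^ 2) * (1 - 0 ^ 2)) * (‖T‖ ^ 2 * (1 / ((1 - x ^ 2) * (1 - x ^ 2)))) *
          ((1 - x ^ 2) ^ 4) := by gcongr
    generalize 1 - x ^ 2 = d at *
    field_simp at h3
    linarith
  have hlim : Tendsto (fun x : ℝ => ‖T‖ ^ 2 * (1 - x ^ 2)) (𝓝[<] 1) (𝓝 0) := by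
    have : ContinuousAt (fun x : ℝ => ‖T‖ ^ 2 * (1 - x ^ 2)) 1 := by fun_prop
    simpa using this.tendsto.mono_left nhdsWithin_le_nhds
  obtain ⟨x, hx, hx1, hx0⟩ := ((hlim.eventually_lt_const one_pos).and
    ((eventually_mem_nhdsWithin (s := Set.Iio 1)).and (Filter.Eventually.filter_mono
      nhdsWithin_le_nhds (eventually_ge_nhds one_pos)))).exists
  exact (key x hx0 hx1).not_gt hx

/-- for `N ≥ 2` there are analytic `Φ₁, Φ₂ : 𝔻^N → 𝔻^N` with the same
image such that `C_{Φ₁}` is not bounded on `H²(𝔻^N)` while `C_{Φ₂}` is compact with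
`β_N(C_{Φ₂}) = 0`. -/
theorem stmt_14 (N : ℕ) (hN : 2 ≤ N) :
    ∃ Φ₁ Φ₂ : (Fin N → ℂ) → (Fin N → ℂ),
      Set.MapsTo Φ₁ (polyDisk N) (polyDisk N) ∧ Set.MapsTo Φ₂ (polyDisk N) (polyDisk N) ∧
      DifferentiableOn ℂ Φ₁ (polyDisk N) ∧ DifferentiableOn ℂ Φ₂ (polyDisk N) ∧
      Φ₁ '' polyDisk N = Φ₂ '' polyDisk N ∧
      (¬ ∃ T : H2poly N →L[ℂ] H2poly N, IsCompOpPoly Φ₁ T) ∧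
      ∃ T₂ : H2poly N →L[ℂ] H2poly N, IsCompOpPoly Φ₂ T₂ ∧ IsCompactOperator ⇑T₂ ∧
        Filter.Tendsto
          (fun n : ℕ => approxNum (n + 1) T₂ ^ (1 / ((n : ℝ) + 1) ^ (1 / (N : ℝ))))
          Filter.atTop (nhds 0) := by
  obtain ⟨M, rfl⟩ : ∃ M, N = M + 2 := ⟨N - 2, by omega⟩
  have hmem : ∀ i : Fin (M + 2), MapsTo (fun z : Fin (M + 2) → ℂ => z i) (polyDisk (M + 2))
      (Metric.ball 0 1) := fun i z hz => mem_ball_zero_iff.2 (hz i)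
  have hproj : ∀ i : Fin (M + 2), Differentiable ℂ fun z : Fin (M + 2) → ℂ => z i := fun i =>
    differentiable_apply i
  exact ⟨fun z => diagPoint M (z 0), slowSymbol M, fun z hz => diagPoint_mem (hz 0),
    fun z hz => diagPoint_mem (norm_mul_slowFun_lt hz),
    ((differentiable_diagPoint M).comp (hproj 0)).differentiableOn,
    (differentiable_diagPoint M).comp_differentiableOn ((hproj 0).differentiableOn.mul
      (differentiableOn_slowFun.comp (hproj 1).differentiableOn (hmem 1))),
    image_slowSymbol M, not_exists_compOp_diag M, exists_compOp_slowSymbol M⟩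

end
end
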